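/- Let F be a cone subequation on ℝⁿ satisfying condition (F3), let Ω ⊂ ℝⁿ be a bounded domain with smooth strictly F-convex boundary, and let Σ ⊂ Ω be a compact subset. Suppose there exists a continuous function h : Ω̄ → [−∞,∞) such that Σ = h⁻¹(−∞), h is F-subharmonic on Ω, and h is F-harmonic on Ω ∖ Σ. Then for every φ ∈ C(∂Ω): (Existence) there exists H, continuous on Ω̄ ∖ Σ, F-harmonic on Ω ∖ Σ, with H = φ on ∂Ω, and with constants c, C ∈ ℝ such that h + c ≤ H ≤ h + C on Ω ∖ Σ. (Uniqueness) There is at most one continuous function on Ω̄ ∖ Σ satisfying these three conditions, and for uniqueness the strict F-convexity of ∂Ω is not required. -/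

import Mathlib

open scoped Topology Classical
open Filter

noncomputable section

/-- Euclidean space ℝⁿ. -/
abbrev EucSp (n : ℕ) := EuclideanSpace ℝ (Fin n)

/-- The space Sym²(ℝⁿ) of symmetric real n×n matrices, with its subspace topology. -/
abbrev SymMat (n : ℕ) := selfAdjoint (Matrix (Fin n) (Fin n) ℝ)

variable {n : ℕ}

/-- The matrix of the orthogonal projection onto the line ℝ·e (for a unit vector e). -/
def projMat (e : EucSp n) : Matrix (Fin n) (Fin n) ℝ := Matrix.of fun i j => e i * e j

lemma projMat_selfAdjoint (e : EucSp n) :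
    projMat e ∈ selfAdjoint (Matrix (Fin n) (Fin n) ℝ) := by
  rw [selfAdjoint.mem_iff]
  ext i j
  simp [projMat, Matrix.star_apply, mul_comm]

/-- P_e, the projection onto ℝ·e, as an element of Sym²(ℝⁿ). -/
def symProj (e : EucSp n) : SymMat n := ⟨projMat e, projMat_selfAdjoint e⟩

/-- The matrix P_{e⊥} − (p−1)·P_e. -/
def charMatM (p : ℝ) (e : EucSp n) : Matrix (Fin n) (Fin n) ℝ :=
  (1 - projMat e) - (p - 1) • projMat e

lemma charMatM_selfAdjoint (p : ℝ) (e : EucSp n) :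
    charMatM p e ∈ selfAdjoint (Matrix (Fin n) (Fin n) ℝ) := by
  have h := projMat_selfAdjoint e
  rw [selfAdjoint.mem_iff] at h ⊢
  simp [charMatM, star_sub, star_smul, star_one, h]

/-- P_{e⊥} − (p−1)·P_e as an element of Sym²(ℝⁿ). -/
def charMat (p : ℝ) (e : EucSp n) : SymMat n := ⟨charMatM p e, charMatM_selfAdjoint p e⟩

/-- A (constant coefficient, pure second order) cone subequation on ℝⁿ: a nonempty,
closed, proper subset of Sym²(ℝⁿ) satisfying positivity (F1) and the cone property (F2). -/
structure ConeSubequation (n : ℕ) where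
  carrier : Set (SymMat n)
  nonempty' : carrier.Nonempty
  proper' : carrier ≠ Set.univ
  isClosed' : IsClosed carrier
  f1 : ∀ A ∈ carrier, ∀ P : SymMat n, (P : Matrix (Fin n) (Fin n) ℝ).PosSemidef → A + P ∈ carrier
  f2 : ∀ A ∈ carrier, ∀ t : ℝ, 0 < t → t • A ∈ carrier

/-- The dual of a set of symmetric matrices: F̃ = {A : −A ∉ Int F}. -/
def dualSet (S : Set (SymMat n)) : Set (SymMat n) := {A | -A ∉ interior S}

/-- The subequation P = {A ≥ 0} of positive semidefinite matrices. -/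
def PosP (n : ℕ) : Set (SymMat n) := {A | (A : Matrix (Fin n) (Fin n) ℝ).PosSemidef}

/-- The Hessian matrix (D²f)(x) of a real function on ℝⁿ. -/
def hessMatrix (f : EucSp n → ℝ) (x : EucSp n) : Matrix (Fin n) (Fin n) ℝ :=
  Matrix.of fun i j =>
    iteratedFDeriv ℝ 2 f x ![EuclideanSpace.single i 1, EuclideanSpace.single j 1]

/-- ψ is a test function for u at x₀ (relative to the set X): ψ is C² near x₀,
u ≤ ψ near x₀ (within X), and u(x₀) = ψ(x₀). -/
def IsTestAt (X : Set (EucSp n)) (u : EucSp n → EReal) (ψ : EucSp n → ℝ) (x₀ : EucSp n) :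
    Prop :=
  ContDiffAt ℝ 2 ψ x₀ ∧ (∀ᶠ x in 𝓝[X] x₀, u x ≤ (ψ x : EReal)) ∧ u x₀ = (ψ x₀ : EReal)

/-- u admits no test functions at x₀ (relative to X). -/
def NoTestAt (X : Set (EucSp n)) (u : EucSp n → EReal) (x₀ : EucSp n) : Prop :=
  ∀ ψ : EucSp n → ℝ, ¬ IsTestAt X u ψ x₀

/-- u is S-subharmonic on X (viscosity sense): u is upper semicontinuous on X with values
in [−∞,∞), and for every test function ψ for u at a point of X, the Hessian of ψ there
lies in S. -/
def FSubharmonicOn (S : Set (SymMat n)) (X : Set (EucSp n)) (u : EucSp n → EReal) : Prop :=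
  UpperSemicontinuousOn u X ∧ (∀ x ∈ X, u x ≠ ⊤) ∧
    ∀ x₀ ∈ X, ∀ ψ : EucSp n → ℝ, IsTestAt X u ψ x₀ →
      hessMatrix ψ x₀ ∈ Subtype.val '' S

/-- u is F-harmonic on X: u is F-subharmonic and −u is F̃-subharmonic on X. -/
def FHarmonicOn (F : ConeSubequation n) (X : Set (EucSp n)) (u : EucSp n → EReal) : Prop :=
  FSubharmonicOn F.carrier X u ∧ FSubharmonicOn (dualSet F.carrier) X (fun x => -u x)

/-- u is subaffine on X, i.e. P̃-subharmonic on X. -/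
def SubaffineOn (X : Set (EucSp n)) (u : EucSp n → EReal) : Prop :=
  FSubharmonicOn (dualSet (PosP n)) X u

/-- h is a downward-pointing singular F-harmonic at x₀ on the neighborhood U:
continuous, F-subharmonic on U, F-harmonic on U∖{x₀}, with a strict minimum at x₀, and
either of polar type (h(x₀) = −∞) or of finite type (h(x₀) > −∞, no test functions at x₀). -/
structure DPSingular (F : ConeSubequation n) (U : Set (EucSp n)) (x₀ : EucSp n)
    (h : EucSp n → EReal) : Prop where
  isOpen' : IsOpen U
  mem : x₀ ∈ U
  cont : ContinuousOn h U
  subh : FSubharmonicOn F.carrier U h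
  harm : FHarmonicOn F (U \ {x₀}) h
  strictMin : ∀ x ∈ U, x ≠ x₀ → h x₀ < h x
  polarOrFinite : h x₀ = ⊥ ∨ (h x₀ ≠ ⊥ ∧ NoTestAt U h x₀)

/-- Polar-case asymptotic equivalence H ≈ h at x₀: h − C ≤ H ≤ h + C near x₀. -/
def PolarAsymp (H : EucSp n → ℝ) (h : EucSp n → EReal) (x₀ : EucSp n) : Prop :=
  ∃ C : ℝ, ∀ᶠ x in 𝓝[≠] x₀, h x - (C : EReal) ≤ (H x : EReal) ∧ (H x : EReal) ≤ h x + (C : EReal)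

/-- Finite-case asymptotic equivalence H ∼ h at x₀:
lim_{x→x₀} (H(x) − H(x₀))/(h(x) − h(x₀)) = 1. -/
def FiniteAsymp (H : EucSp n → ℝ) (h : EucSp n → EReal) (x₀ : EucSp n) : Prop :=
  Tendsto (fun x => (H x - H x₀) / ((h x).toReal - (h x₀).toReal)) (𝓝[≠] x₀) (𝓝 1)

/-- Ω is a bounded domain: open, connected and bounded. -/
def IsBoundedDomain (Ω : Set (EucSp n)) : Prop :=
  IsOpen Ω ∧ IsConnected Ω ∧ Bornology.IsBounded Ω

/-- Condition (F3): −P_e ∉ F for every unit vector e. -/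
def CondF3 (F : ConeSubequation n) : Prop :=
  ∀ e : EucSp n, ‖e‖ = 1 → -(symProj e) ∉ F.carrier

/-- The inward unit normal −∇ρ(x)/|∇ρ(x)| of the hypersurface {ρ = 0} bounding {ρ < 0}. -/
def innerNormal (ρ : EucSp n → ℝ) (x : EucSp n) : EucSp n :=
  -(‖gradient ρ x‖⁻¹ • gradient ρ x)

/-- The second fundamental form of {ρ = 0} at x with respect to the inward normal,
extended by zero on the normal line: the tangential part of Hess ρ(x)/|∇ρ(x)|. -/
def secondFF (ρ : EucSp n → ℝ) (x : EucSp n) : Matrix (Fin n) (Fin n) ℝ :=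
  ‖gradient ρ x‖⁻¹ •
    ((1 - projMat (innerNormal ρ x)) * hessMatrix ρ x * (1 - projMat (innerNormal ρ x)))

/-- Ω has smooth boundary which is strictly F-convex: Ω is globally defined by a smooth
defining function ρ with nonvanishing gradient along ∂Ω, and at every boundary point
II_x + t·P_{ν(x)} ∈ Int F for all sufficiently large t. -/
def StrictlyConvexBoundary (F : ConeSubequation n) (Ω : Set (EucSp n)) : Prop :=
  ∃ ρ : EucSp n → ℝ, ContDiff ℝ (⊤ : ℕ∞) ρ ∧ Ω = {x | ρ x < 0} ∧
    ∀ x ∈ frontier Ω, gradient ρ x ≠ 0 ∧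
      ∃ t₀ : ℝ, ∀ t ≥ t₀,
        secondFF ρ x + t • projMat (innerNormal ρ x) ∈ Subtype.val '' interior F.carrier

/-- F is invariant under O(n): gᵀ A g ∈ F for every orthogonal g and A ∈ F. -/
def OrthInvariant (F : ConeSubequation n) : Prop :=
  ∀ g : Matrix (Fin n) (Fin n) ℝ, g.transpose * g = 1 →
    ∀ A ∈ F.carrier, ∀ B : SymMat n,
      (B : Matrix (Fin n) (Fin n) ℝ) = g.transpose * (A : Matrix (Fin n) (Fin n) ℝ) * g →
      B ∈ F.carrier

/-- F has Riesz characteristic p: P_{e⊥} − (p−1)P_e ∈ ∂F for every unit vector e. -/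
def HasRieszChar (F : ConeSubequation n) (p : ℝ) : Prop :=
  ∀ e : EucSp n, ‖e‖ = 1 → charMat p e ∈ frontier F.carrier

/-- The Riesz kernel K_p. -/
def rieszKernel (p : ℝ) (x : EucSp n) : ℝ :=
  if p = 2 then Real.log ‖x‖ else -(p - 2)⁻¹ * ‖x‖ ^ (2 - p)

/-- A solution for the (DPPS) with singularities on a compact polar set Σ (= Z):
H continuous on Ω̄∖Z, F-harmonic on Ω∖Z, boundary values φ, and h + c ≤ H ≤ h + C. -/
def IsPolarSetSolution {n : ℕ} (F : ConeSubequation n) (Ω Z : Set (EucSp n))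
    (φ : EucSp n → ℝ) (h : EucSp n → EReal) (H : EucSp n → ℝ) : Prop :=
  ContinuousOn H (closure Ω \ Z) ∧
  FHarmonicOn F (Ω \ Z) (fun y => (H y : EReal)) ∧
  (∀ y ∈ frontier Ω, H y = φ y) ∧
  ∃ c C : ℝ, ∀ y ∈ Ω \ Z,
    h y + (c : EReal) ≤ (H y : EReal) ∧ (H y : EReal) ≤ h y + (C : EReal)

open scoped RealInnerProductSpace in
/-- `ξ` is a subgradient of `f` at `x`. -/
def IsSubgrad {E : Type*} [NormedAddCommGroup E] [InnerProductSpace ℝ E]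
    (f : E → ℝ) (x ξ : E) : Prop :=
  ∀ z, f x + ⟪ξ, z - x⟫ ≤ f z

section Alexandrov

open MeasureTheory Measure Module
open scoped RealInnerProductSpace

variable {E : Type*} [NormedAddCommGroup E] [InnerProductSpace ℝ E]

lemma IsSubgrad.monotone {f : E → ℝ} {x ξ x' ξ' : E} (h : IsSubgrad f x ξ)
    (h' : IsSubgrad f x' ξ') : 0 ≤ ⟪ξ - ξ', x - x'⟫ := by
  have h1 := h x'
  have h2 := h' x
  have h3 : ⟪ξ, x' - x⟫ = -⟪ξ, x - x'⟫ := by rw [← neg_sub, inner_neg_right]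
  rw [inner_sub_left]
  linarith

/-- At a point where `f` is touched from above by a paraboloid of opening `k`, subgradients at
nearby points differ from the gradient at most linearly. -/
lemma IsSubgrad.norm_sub_le {f : E → ℝ} {x ξ x' ξ' : E} {k : ℝ} (hk : 0 < k)
    (h : IsSubgrad f x ξ) (hup : ∀ z, f z ≤ f x + ⟪ξ, z - x⟫ + k * ‖z - x‖ ^ 2)
    (h' : IsSubgrad f x' ξ') : ‖ξ' - ξ‖ ≤ 4 * k * ‖x' - x‖ := by
  set d := ξ' - ξ with hd
  have h1 := hup (x + (2 * k)⁻¹ • d)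
  have h2 := h' (x + (2 * k)⁻¹ • d)
  have h3 := h x'
  rw [add_sub_cancel_left, norm_smul, inner_smul_right] at h1
  rw [show x + (2 * k)⁻¹ • d - x' = (2 * k)⁻¹ • d - (x' - x) by abel, inner_sub_right,
    inner_smul_right] at h2
  have h4 : ⟪ξ', d⟫ = ⟪ξ, d⟫ + ‖d‖ ^ 2 := by
    rw [← real_inner_self_eq_norm_sq, ← inner_add_left, hd]; congr 1; abel
  have h5 : ⟪ξ', x' - x⟫ = ⟪ξ, x' - x⟫ + ⟪d, x' - x⟫ := by
    rw [← inner_add_left, hd]; congr 1; abel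
  have h6 := real_inner_le_norm d (x' - x)
  rw [h4, h5] at h2
  have h7 : ‖(2 * k)⁻¹‖ = (2 * k)⁻¹ := by
    rw [Real.norm_of_nonneg]; positivity
  rw [h7] at h1
  have h8 : k * ((2 * k)⁻¹ * ‖d‖) ^ 2 = ‖d‖ ^ 2 / (4 * k) := by field_simp; ring
  have h9 : (2 * k)⁻¹ * ‖d‖ ^ 2 = ‖d‖ ^ 2 / (4 * k) + ‖d‖ ^ 2 / (4 * k) := by field_simp; ring
  have h10 : ‖d‖ ^ 2 / (4 * k) ≤ ‖d‖ * ‖x' - x‖ := by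
    rw [mul_add, h9] at h2
    rw [h8] at h1
    linarith
  rw [div_le_iff₀ (by positivity)] at h10
  rcases (norm_nonneg d).eq_or_lt with h0 | h0
  · rw [← h0]; positivity
  · by_contra! hc
    nlinarith

/-- Quadratic comparison along a segment from increments of first-order type. -/
lemma sub_le_of_increments {g : ℝ → ℝ} {a b C : ℝ}
    (h : ∀ s t, 0 ≤ s → s ≤ t → t ≤ 1 → g t - g s ≤ (t - s) * (a + t * b) + C * (t - s) ^ 2) :
    g 1 - g 0 ≤ a + b / 2 := by
  set C' := b / 2 + C with hC'
  have key : ∀ N : ℕ, 0 < N → ∀ i : ℕ, i ≤ N →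
      (g (i / N) - a * (i / N) - b * (i / N) ^ 2 / 2) - g 0 ≤ i * (C' / N ^ 2) := by
    intro N hN i
    have hN' : (0 : ℝ) < N := by exact_mod_cast hN
    induction i with
    | zero => intro _; simp
    | succ i ih =>
      intro hi
      have h1 := ih (by omega)
      have h2 := h (i / N) ((i + 1 : ℕ) / N) (by positivity) (by gcongr; simp)
        (by rw [div_le_one hN']; exact_mod_cast hi)
      have h3 : ((i + 1 : ℕ) / N : ℝ) = i / N + 1 / N := by push_cast; ring
      rw [h3] at h2 ⊢
      have h4 : (1 / N : ℝ) ^ 2 = 1 / N ^ 2 := by rw [div_pow, one_pow]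
      have h5 : ((i + 1 : ℕ) : ℝ) * (C' / N ^ 2) = i * (C' / N ^ 2) + C' * (1 / N) ^ 2 := by
        push_cast; rw [h4]; ring
      rw [h5, hC']
      rw [hC'] at h1
      nlinarith
  have lim : ∀ N : ℕ, 0 < N → g 1 - g 0 - (a + b / 2) ≤ C' * (1 / (N : ℝ)) := by
    intro N hN
    have hN' : (0 : ℝ) < N := by exact_mod_cast hN
    have := key N hN N le_rfl
    rw [div_self hN'.ne'] at this
    have h2 : (N : ℝ) * (C' / N ^ 2) = C' * (1 / (N : ℝ)) := by field_simp
    rw [h2] at this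
    linarith
  have ht : Tendsto (fun N : ℕ => C' * (1 / (N : ℝ))) atTop (𝓝 (C' * 0)) :=
    tendsto_one_div_atTop_nhds_zero_nat.const_mul _
  have := ge_of_tendsto ht (eventually_atTop.2 ⟨1, fun N hN => lim N hN⟩)
  linarith

/-- Second-order expansion from a first-order expansion of the subgradients. -/
lemma taylor_of_subgrad {f : E → ℝ} (hf : ∀ x, ∃ ξ, IsSubgrad f x ξ) {x ξ : E} (S : E →L[ℝ] E)
    (hS : ∀ θ > 0, ∀ᶠ w in 𝓝 (0 : E), ∀ ξ', IsSubgrad f (x + w) ξ' → ‖ξ' - ξ - S w‖ ≤ θ * ‖w‖) :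
    ∀ θ > 0, ∀ᶠ w in 𝓝 (0 : E),
      |f (x + w) - f x - ⟪ξ, w⟫ - ⟪S w, w⟫ / 2| ≤ θ * ‖w‖ ^ 2 := by
  intro θ hθ
  obtain ⟨δ, hδ, hball⟩ := Metric.eventually_nhds_iff.1 (hS θ hθ)
  refine Metric.eventually_nhds_iff.2 ⟨δ, hδ, fun w hw => ?_⟩
  choose X hX using hf
  have hest : ∀ t, 0 ≤ t → t ≤ 1 →
      |⟪X (x + t • w), w⟫ - (⟪ξ, w⟫ + t * ⟪S w, w⟫)| ≤ t * (θ * ‖w‖ ^ 2) := by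
    intro t h0 h1
    have := hball (y := t • w) (by
      rw [dist_zero_right] at hw ⊢
      rw [norm_smul, Real.norm_of_nonneg h0]
      nlinarith [norm_nonneg w]) (X (x + t • w)) (hX _)
    have h2 : ⟪X (x + t • w), w⟫ - (⟪ξ, w⟫ + t * ⟪S w, w⟫)
        = ⟪X (x + t • w) - ξ - S (t • w), w⟫ := by
      rw [inner_sub_left, inner_sub_left, map_smul, inner_smul_left]; simp; ring
    rw [h2]
    calc _ ≤ ‖X (x + t • w) - ξ - S (t • w)‖ * ‖w‖ := abs_real_inner_le_norm _ _
      _ ≤ (θ * ‖t • w‖) * ‖w‖ := by gcongr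
      _ = _ := by rw [norm_smul, Real.norm_of_nonneg h0]; ring
  have hseg : ∀ s t : ℝ, (x + t • w) - (x + s • w) = (t - s) • w := by
    intro s t; rw [sub_smul]; abel
  have hinc : ∀ s t, f (x + s • w) + (t - s) * ⟪X (x + s • w), w⟫ ≤ f (x + t • w) := by
    intro s t
    have := hX (x + s • w) (x + t • w)
    rwa [hseg, inner_smul_right] at this
  have hup := sub_le_of_increments (g := fun t => f (x + t • w)) (a := ⟪ξ, w⟫)
    (b := ⟪S w, w⟫ + θ * ‖w‖ ^ 2) (C := 0) (by
      intro s t hs hst ht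
      have h1 := hinc t s
      have h2 := (abs_le.1 (hest t (hs.trans hst) ht)).2
      have h3 : 0 ≤ t - s := by linarith
      nlinarith [mul_le_mul_of_nonneg_left h2 h3])
  have hlo := sub_le_of_increments (g := fun t => -f (x + t • w)) (a := -⟪ξ, w⟫)
    (b := -⟪S w, w⟫ + θ * ‖w‖ ^ 2) (C := ⟪S w, w⟫ - θ * ‖w‖ ^ 2) (by
      intro s t hs hst ht
      have h1 := hinc s t
      have h2 := (abs_le.1 (hest s hs (hst.trans ht))).1
      have h3 : 0 ≤ t - s := by linarith
      nlinarith [mul_le_mul_of_nonneg_left h2 h3])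
  simp only [one_smul, zero_smul, add_zero] at hup hlo
  rw [abs_le]
  have : 0 ≤ θ * ‖w‖ ^ 2 := by positivity
  constructor <;> linarith

variable [MeasurableSpace E] [BorelSpace E]

lemma hausdorff_image_eq_zero {f : E → E} {K : NNReal} {s : Set E} (hf : LipschitzOnWith K f s)
    (hs : μH[finrank ℝ E] s = 0) : μH[finrank ℝ E] (f '' s) = 0 := by
  have := hf.hausdorffMeasure_image_le (d := finrank ℝ E) (by positivity)
  rw [hs, mul_zero] at this
  exact le_antisymm this (zero_le)

/-- A form of Alexandrov's theorem: outside a null set, a convex function which is touched from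
above by a paraboloid has a second-order Taylor expansion. -/
theorem exists_taylor_ae [FiniteDimensional ℝ E] {f : E → ℝ} (hf : ∀ x, ∃ ξ, IsSubgrad f x ξ) :
    ∃ N : Set E, μH[finrank ℝ E] N = 0 ∧ ∀ x ∉ N, ∀ ξ k, 0 < k → IsSubgrad f x ξ →
      (∀ z, f z ≤ f x + ⟪ξ, z - x⟫ + k * ‖z - x‖ ^ 2) →
      ∃ S : E →L[ℝ] E, ∀ θ > 0, ∀ᶠ w in 𝓝 (0 : E),
        |f (x + w) - f x - ⟪ξ, w⟫ - ⟪S w, w⟫ / 2| ≤ θ * ‖w‖ ^ 2 := by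
  set D : Set E := {y | ∃ x, IsSubgrad f x (y - x)} with hD
  have hex : ∀ y, ∃ x, y ∈ D → IsSubgrad f x (y - x) := fun y => by
    by_cases hy : y ∈ D
    · obtain ⟨x, hx⟩ := hy; exact ⟨x, fun _ => hx⟩
    · exact ⟨0, fun h => absurd h hy⟩
  choose J hJ using hex
  have hcontr : ∀ {x y x' y'}, IsSubgrad f x (y - x) → IsSubgrad f x' (y' - x') →
      ‖x - x'‖ ≤ ‖y - y'‖ := by
    intro x y x' y' h h'
    have h1 := h.monotone h'
    rw [show y - x - (y' - x') = (y - y') - (x - x') by abel, inner_sub_left,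
      real_inner_self_eq_norm_sq] at h1
    have h2 := real_inner_le_norm (y - y') (x - x')
    rcases (norm_nonneg (x - x')).eq_or_lt with h0 | h0
    · rw [← h0]; positivity
    · by_contra! hc
      nlinarith
  have hlip : LipschitzOnWith 1 J D := by
    apply LipschitzOnWith.of_dist_le_mul
    intro y hy y' hy'
    rw [dist_eq_norm, dist_eq_norm, NNReal.coe_one, one_mul]
    exact hcontr (hJ y hy) (hJ y' hy')
  set N1 : Set E := {y | y ∈ D ∧ ¬ DifferentiableWithinAt ℝ J D y} with hN1
  have hN1z : μH[finrank ℝ E] N1 = 0 := by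
    have := hlip.ae_differentiableWithinAt_of_mem (μ := μH[finrank ℝ E])
    rw [ae_iff] at this
    simpa only [Classical.not_imp] using this
  set N2 : Set E := {y | y ∈ D ∧ DifferentiableWithinAt ℝ J D y ∧ (fderivWithin ℝ J D y).det = 0}
    with hN2
  have hJ1 : μH[finrank ℝ E] (J '' N1) = 0 :=
    hausdorff_image_eq_zero (hlip.mono fun y hy => hy.1) hN1z
  have hJ2 : μH[finrank ℝ E] (J '' N2) = 0 :=
    addHaar_image_eq_zero_of_det_fderivWithin_eq_zero _ (f' := fderivWithin ℝ J D)
      (fun y hy => hy.2.1.hasFDerivWithinAt.mono fun z hz => hz.1) (fun y hy => hy.2.2)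
  refine ⟨J '' N1 ∪ J '' N2, measure_union_null hJ1 hJ2, ?_⟩
  intro x hx ξ k hk hξ hup
  set y := x + ξ with hy
  have hyx : y - x = ξ := by rw [hy]; abel
  have hyD : y ∈ D := ⟨x, by rwa [hyx]⟩
  have hJuniq : ∀ {x' ξ'}, IsSubgrad f x' ξ' → J (x' + ξ') = x' := by
    intro x' ξ' h'
    have h1 : IsSubgrad f x' (x' + ξ' - x') := by rwa [add_sub_cancel_left]
    have := hcontr (hJ _ ⟨x', h1⟩) h1
    rw [sub_self, norm_zero] at this
    exact sub_eq_zero.1 (norm_le_zero_iff.1 this)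
  have hJy : J y = x := hJuniq hξ
  have hdiff : DifferentiableWithinAt ℝ J D y := by
    by_contra hc; exact hx (Or.inl ⟨y, ⟨hyD, hc⟩, hJy⟩)
  have hdet : (fderivWithin ℝ J D y).det ≠ 0 := by
    intro hc; exact hx (Or.inr ⟨y, ⟨hyD, hdiff, hc⟩, hJy⟩)
  set L := fderivWithin ℝ J D y with hL
  let e := ContinuousLinearMap.toContinuousLinearEquivOfDetNeZero L hdet
  have heL : ∀ v, e v = L v := fun v => rfl
  refine ⟨(e.symm : E →L[ℝ] E) - ContinuousLinearMap.id ℝ E, taylor_of_subgrad hf _ ?_⟩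
  intro θ hθ
  set M := ‖(e.symm : E →L[ℝ] E)‖ with hM
  set c := θ / ((M + 1) * (1 + 4 * k)) with hc
  have hMn : 0 ≤ M := norm_nonneg _
  have hcpos : 0 < c := by positivity
  have hfd := hdiff.hasFDerivWithinAt
  rw [hasFDerivWithinAt_iff_isLittleO, Asymptotics.isLittleO_iff] at hfd
  obtain ⟨r, hr, hball⟩ := Metric.eventually_nhds_iff.1 (eventually_nhdsWithin_iff.1 (hfd hcpos))
  refine Metric.eventually_nhds_iff.2 ⟨r / (1 + 4 * k), by positivity, fun w hw ξ' hξ' => ?_⟩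
  have h1 := hξ.norm_sub_le hk hup hξ'
  rw [add_sub_cancel_left] at h1
  have h2 : ‖(x + w + ξ') - y‖ ≤ (1 + 4 * k) * ‖w‖ := by
    rw [hy, show x + w + ξ' - (x + ξ) = w + (ξ' - ξ) by abel]
    calc _ ≤ ‖w‖ + ‖ξ' - ξ‖ := norm_add_le _ _
      _ ≤ _ := by linarith
  have h3 : x + w + ξ' ∈ D := ⟨x + w, by rwa [add_sub_cancel_left]⟩
  have h4 := hball (y := x + w + ξ') (by
    rw [dist_eq_norm]
    rw [dist_zero_right, lt_div_iff₀ (by positivity)] at hw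
    linarith) h3
  rw [hJuniq hξ', hJy, add_sub_cancel_left] at h4
  have h5 : ξ' - ξ - ((e.symm : E →L[ℝ] E) - ContinuousLinearMap.id ℝ E) w
      = -(e.symm : E →L[ℝ] E) (w - L (x + w + ξ' - y)) := by
    rw [map_sub, ← heL]
    simp only [_root_.sub_apply, ContinuousLinearEquiv.coe_coe,
      ContinuousLinearEquiv.symm_apply_apply, ContinuousLinearMap.id_apply, hy]
    abel
  rw [h5, norm_neg]
  calc _ ≤ M * ‖w - L (x + w + ξ' - y)‖ := ContinuousLinearMap.le_opNorm _ _
    _ ≤ M * (c * ((1 + 4 * k) * ‖w‖)) := by gcongr; exact h4.trans (by gcongr)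
    _ ≤ (M + 1) * (c * ((1 + 4 * k) * ‖w‖)) := by gcongr; linarith
    _ = θ * ‖w‖ := by rw [hc]; field_simp

end Alexandrov

section Jensen

open MeasureTheory Measure Module
open scoped RealInnerProductSpace

variable {E : Type*} [NormedAddCommGroup E] [InnerProductSpace ℝ E]

lemma IsSubgrad.add_eq_of_isMax {f₁ f₂ : E → ℝ} {k : ℝ} {p x ξ₁ ξ₂ : E} (hk : 0 < k)
    (h₁ : IsSubgrad f₁ x ξ₁) (h₂ : IsSubgrad f₂ x ξ₂)
    (hx : ∀ z, f₁ z + f₂ z - k * ‖z‖ ^ 2 - ⟪p, z⟫ ≤ f₁ x + f₂ x - k * ‖x‖ ^ 2 - ⟪p, x⟫) :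
    ξ₁ + ξ₂ - (2 * k) • x = p := by
  set d := ξ₁ + ξ₂ - (2 * k) • x - p with hd
  have key : ∀ v, ⟪d, v⟫ ≤ k * ‖v‖ ^ 2 := by
    intro v
    have a1 := h₁ (x + v)
    have a2 := h₂ (x + v)
    have a3 := hx (x + v)
    rw [add_sub_cancel_left] at a1 a2
    rw [norm_add_sq_real, inner_add_right] at a3
    rw [hd, inner_sub_left, inner_sub_left, inner_add_left, inner_smul_left]
    simp only [conj_trivial]
    nlinarith
  have h1 := key ((2 * k)⁻¹ • d)
  rw [inner_smul_right, norm_smul, real_inner_self_eq_norm_sq, Real.norm_of_nonneg (by positivity)]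
    at h1
  have h2 : k * ((2 * k)⁻¹ * ‖d‖) ^ 2 = (2 * k)⁻¹ * ‖d‖ ^ 2 / 2 := by field_simp
  rw [h2] at h1
  have h3 : (2 * k)⁻¹ * ‖d‖ ^ 2 ≤ 0 := by linarith
  have h4 : ‖d‖ ^ 2 ≤ 0 := by
    by_contra! hc
    have : 0 < (2 * k)⁻¹ * ‖d‖ ^ 2 := by positivity
    linarith
  have h5 : d = 0 := by
    rw [← norm_eq_zero]; nlinarith [norm_nonneg d]
  exact sub_eq_zero.1 h5

lemma IsSubgrad.upper_of_isMax {f₁ f₂ : E → ℝ} {k : ℝ} {p x ξ₁ ξ₂ : E} (hk : 0 < k)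
    (h₁ : IsSubgrad f₁ x ξ₁) (h₂ : IsSubgrad f₂ x ξ₂)
    (hx : ∀ z, f₁ z + f₂ z - k * ‖z‖ ^ 2 - ⟪p, z⟫ ≤ f₁ x + f₂ x - k * ‖x‖ ^ 2 - ⟪p, x⟫) (z : E) :
    f₁ z ≤ f₁ x + ⟪ξ₁, z - x⟫ + k * ‖z - x‖ ^ 2 := by
  have hp := h₁.add_eq_of_isMax hk h₂ hx
  have a2 := h₂ z
  have a3 := hx z
  have e1 : ξ₁ = p + (2 * k) • x - ξ₂ := by rw [← hp]; abel
  have e2 : ‖z‖ ^ 2 = ‖x‖ ^ 2 + 2 * ⟪x, z - x⟫ + ‖z - x‖ ^ 2 := by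
    rw [← norm_add_sq_real]; congr 2; abel
  rw [e1, inner_sub_left, inner_add_left, inner_smul_left]
  simp only [conj_trivial]
  rw [e2] at a3
  have e3 : ⟪p, z - x⟫ = ⟪p, z⟫ - ⟪p, x⟫ := inner_sub_right _ _ _
  nlinarith

/-- A function bounded by `o(‖w‖²)` which is homogeneous of degree two is nonpositive. -/
lemma nonpos_of_homogeneous {q : E → ℝ} (hq : ∀ (t : ℝ) w, q (t • w) = t ^ 2 * q w)
    (h : ∀ θ > 0, ∀ᶠ w in 𝓝 (0 : E), q w ≤ θ * ‖w‖ ^ 2) (w : E) : q w ≤ 0 := by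
  have key : ∀ θ > 0, q w ≤ θ * ‖w‖ ^ 2 := by
    intro θ hθ
    have ht : Tendsto (fun t : ℝ => t • w) (𝓝[>] 0) (𝓝 0) := by
      have : Tendsto (fun t : ℝ => t • w) (𝓝 0) (𝓝 ((0 : ℝ) • w)) :=
        tendsto_id.smul_const w
      rw [zero_smul] at this
      exact this.mono_left nhdsWithin_le_nhds
    obtain ⟨t, ht1, ht2⟩ := ((ht.eventually (h θ hθ)).and self_mem_nhdsWithin).exists
    replace ht2 : 0 < t := ht2
    rw [hq, norm_smul, mul_pow, Real.norm_of_nonneg ht2.le] at ht1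
    have : 0 < t ^ 2 := by positivity
    nlinarith
  refine le_of_forall_pos_le_add fun ε hε => ?_
  have := key (ε / (‖w‖ ^ 2 + 1)) (by positivity)
  have h2 : ε / (‖w‖ ^ 2 + 1) * ‖w‖ ^ 2 ≤ ε := by
    rw [div_mul_eq_mul_div, div_le_iff₀ (by positivity)]; nlinarith
  linarith

variable [FiniteDimensional ℝ E]

/-- Jensen's lemma combined with Alexandrov's theorem: if `f₁ + f₂ - k‖·‖²` attains its maximum
after every small linear perturbation, then at some of these maxima both convex functions
have second-order expansions, with the expected matrix inequality. -/
theorem exists_taylor_at_max {f₁ f₂ : E → ℝ} (hf₁ : ∀ x, ∃ ξ, IsSubgrad f₁ x ξ)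
    (hf₂ : ∀ x, ∃ ξ, IsSubgrad f₂ x ξ) {k δ : ℝ} (hk : 0 < k) (hδ : 0 < δ)
    (hmax : ∀ p : E, ‖p‖ < δ → ∃ x, ∀ z,
      f₁ z + f₂ z - k * ‖z‖ ^ 2 - ⟪p, z⟫ ≤ f₁ x + f₂ x - k * ‖x‖ ^ 2 - ⟪p, x⟫) :
    ∃ p x : E, ‖p‖ < δ ∧
      (∀ z, f₁ z + f₂ z - k * ‖z‖ ^ 2 - ⟪p, z⟫ ≤ f₁ x + f₂ x - k * ‖x‖ ^ 2 - ⟪p, x⟫) ∧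
      ∀ ξ₁ ξ₂, IsSubgrad f₁ x ξ₁ → IsSubgrad f₂ x ξ₂ → ∃ S₁ S₂ : E →L[ℝ] E,
        (∀ θ > 0, ∀ᶠ w in 𝓝 (0 : E),
          |f₁ (x + w) - f₁ x - ⟪ξ₁, w⟫ - ⟪S₁ w, w⟫ / 2| ≤ θ * ‖w‖ ^ 2) ∧
        (∀ θ > 0, ∀ᶠ w in 𝓝 (0 : E),
          |f₂ (x + w) - f₂ x - ⟪ξ₂, w⟫ - ⟪S₂ w, w⟫ / 2| ≤ θ * ‖w‖ ^ 2) ∧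
        ∀ w, ⟪S₁ w, w⟫ + ⟪S₂ w, w⟫ ≤ 2 * k * ‖w‖ ^ 2 := by
  borelize E
  obtain ⟨N₁, hN₁, hT₁⟩ := exists_taylor_ae hf₁
  obtain ⟨N₂, hN₂, hT₂⟩ := exists_taylor_ae hf₂
  set C : Set E := {x | ∃ p : E, ‖p‖ < δ ∧ ∀ z,
      f₁ z + f₂ z - k * ‖z‖ ^ 2 - ⟪p, z⟫ ≤ f₁ x + f₂ x - k * ‖x‖ ^ 2 - ⟪p, x⟫} with hC
  choose X₁ hX₁ using hf₁
  choose X₂ hX₂ using hf₂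
  have hCpos : μH[finrank ℝ E] C ≠ 0 := by
    intro h0
    have hlip : LipschitzOnWith (Real.toNNReal (10 * k))
        (fun x => X₁ x + X₂ x - (2 * k) • x) C := by
      apply LipschitzOnWith.of_dist_le_mul
      rintro x ⟨p, hp, hx⟩ y -
      have hx' : ∀ z, f₂ z + f₁ z - k * ‖z‖ ^ 2 - ⟪p, z⟫ ≤ f₂ x + f₁ x - k * ‖x‖ ^ 2 - ⟪p, x⟫ := by
        intro z; have := hx z; linarith
      have b1 := (hX₁ x).norm_sub_le hk ((hX₁ x).upper_of_isMax hk (hX₂ x) hx) (hX₁ y)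
      have b2 := (hX₂ x).norm_sub_le hk ((hX₂ x).upper_of_isMax hk (hX₁ x) hx') (hX₂ y)
      rw [dist_comm, dist_comm x y, dist_eq_norm, dist_eq_norm,
        Real.coe_toNNReal _ (by positivity)]
      have e : X₁ y + X₂ y - (2 * k) • y - (X₁ x + X₂ x - (2 * k) • x)
          = (X₁ y - X₁ x) + (X₂ y - X₂ x) - (2 * k) • (y - x) := by
        rw [smul_sub]; abel
      rw [e]
      calc _ ≤ ‖X₁ y - X₁ x‖ + ‖X₂ y - X₂ x‖ + ‖(2 * k) • (y - x)‖ :=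
            (norm_sub_le _ _).trans (by gcongr; exact norm_add_le _ _)
        _ ≤ _ := by
            rw [norm_smul, Real.norm_of_nonneg (by positivity)]; linarith
    have himg := hausdorff_image_eq_zero hlip h0
    have hsub : Metric.ball (0 : E) δ ⊆ (fun x => X₁ x + X₂ x - (2 * k) • x) '' C := by
      intro p hp
      rw [mem_ball_zero_iff] at hp
      obtain ⟨x, hx⟩ := hmax p hp
      exact ⟨x, ⟨p, hp, hx⟩, (hX₁ x).add_eq_of_isMax hk (hX₂ x) hx⟩
    have h1 := measure_mono_null hsub himg
    exact (Metric.measure_ball_pos μH[finrank ℝ E] (0 : E) hδ).ne' h1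
  have hne : ∃ x ∈ C, x ∉ N₁ ∪ N₂ := by
    by_contra! hc
    exact hCpos (measure_mono_null hc (measure_union_null hN₁ hN₂))
  obtain ⟨x, ⟨p, hp, hx⟩, hxN⟩ := hne
  rw [Set.mem_union, not_or] at hxN
  refine ⟨p, x, hp, hx, fun ξ₁ ξ₂ h₁ h₂ => ?_⟩
  have hx' : ∀ z, f₂ z + f₁ z - k * ‖z‖ ^ 2 - ⟪p, z⟫ ≤ f₂ x + f₁ x - k * ‖x‖ ^ 2 - ⟪p, x⟫ := by
    intro z; have := hx z; linarith
  obtain ⟨S₁, hS₁⟩ := hT₁ x hxN.1 ξ₁ k hk h₁ (h₁.upper_of_isMax hk h₂ hx)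
  obtain ⟨S₂, hS₂⟩ := hT₂ x hxN.2 ξ₂ k hk h₂ (h₂.upper_of_isMax hk h₁ hx')
  refine ⟨S₁, S₂, hS₁, hS₂, fun w => ?_⟩
  have hp := h₁.add_eq_of_isMax hk h₂ hx
  have := nonpos_of_homogeneous
    (q := fun w => ⟪S₁ w, w⟫ + ⟪S₂ w, w⟫ - 2 * k * ‖w‖ ^ 2) (by
      intro t w
      simp only [map_smul, inner_smul_left, inner_smul_right, norm_smul, mul_pow, conj_trivial,
        Real.norm_eq_abs, sq_abs]
      ring) (by
      intro θ hθ
      filter_upwards [hS₁ (θ / 4) (by positivity), hS₂ (θ / 4) (by positivity)] with w a1 a2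
      have b1 := (abs_le.1 a1).1
      have b2 := (abs_le.1 a2).1
      have b3 := hx (x + w)
      rw [norm_add_sq_real, inner_add_right, ← hp, inner_sub_left, inner_sub_left, inner_add_left,
        inner_add_left, inner_smul_left, inner_smul_left] at b3
      simp only [conj_trivial] at b3
      linarith) w
  linarith

end Jensen

section Jets

open scoped RealInnerProductSpace

variable {E : Type*} [NormedAddCommGroup E] [InnerProductSpace ℝ E]

/-- `(p, B)` is a second-order superjet of `u` at `x`. -/
def SupJet (u : E → ℝ) (x : E) (p : E) (B : E →L[ℝ] E) : Prop :=
  ∀ θ > 0, ∀ᶠ w in 𝓝 (0 : E), u (x + w) ≤ u x + ⟪p, w⟫ + ⟪B w, w⟫ / 2 + θ * ‖w‖ ^ 2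

/-- `(p, B)` is a second-order subjet of `u` at `x`. -/
def SubJet (u : E → ℝ) (x : E) (p : E) (B : E →L[ℝ] E) : Prop :=
  ∀ θ > 0, ∀ᶠ w in 𝓝 (0 : E), u x + ⟪p, w⟫ + ⟪B w, w⟫ / 2 - θ * ‖w‖ ^ 2 ≤ u (x + w)

/-- `u` has the second-order expansion given by `(p, B)` at `x`. -/
def HasJet (u : E → ℝ) (x : E) (p : E) (B : E →L[ℝ] E) : Prop :=
  SupJet u x p B ∧ SubJet u x p B

variable {u f g : E → ℝ} {x : E} {p q : E} {B C : E →L[ℝ] E}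

lemma SubJet.neg (h : SubJet u x p B) : SupJet (fun y => -u y) x (-p) (-B) := by
  intro θ hθ
  filter_upwards [h θ hθ] with w hw
  simp only [neg_apply, inner_neg_left]
  linarith

lemma SupJet.neg (h : SupJet u x p B) : SubJet (fun y => -u y) x (-p) (-B) := by
  intro θ hθ
  filter_upwards [h θ hθ] with w hw
  simp only [neg_apply, inner_neg_left]
  linarith

lemma HasJet.neg (h : HasJet u x p B) : HasJet (fun y => -u y) x (-p) (-B) :=
  ⟨h.2.neg, h.1.neg⟩

lemma SupJet.add (h : SupJet f x p B) (h' : SupJet g x q C) :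
    SupJet (fun y => f y + g y) x (p + q) (B + C) := by
  intro θ hθ
  filter_upwards [h (θ / 2) (by positivity), h' (θ / 2) (by positivity)] with w h1 h2
  simp only [add_apply, inner_add_left]
  linarith

lemma SubJet.add (h : SubJet f x p B) (h' : SubJet g x q C) :
    SubJet (fun y => f y + g y) x (p + q) (B + C) := by
  intro θ hθ
  filter_upwards [h (θ / 2) (by positivity), h' (θ / 2) (by positivity)] with w h1 h2
  simp only [add_apply, inner_add_left]
  linarith

lemma HasJet.add (h : HasJet f x p B) (h' : HasJet g x q C) :
    HasJet (fun y => f y + g y) x (p + q) (B + C) := ⟨h.1.add h'.1, h.2.add h'.2⟩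

lemma SupJet.const_mul {t : ℝ} (ht : 0 < t) (h : SupJet u x p B) :
    SupJet (fun y => t * u y) x (t • p) (t • B) := by
  intro θ hθ
  filter_upwards [h (θ / t) (by positivity)] with w h1
  simp only [smul_apply, real_inner_smul_left]
  have := mul_le_mul_of_nonneg_left h1 ht.le
  have e : t * (u x + ⟪p, w⟫ + ⟪B w, w⟫ / 2 + θ / t * ‖w‖ ^ 2)
      = t * u x + t * ⟪p, w⟫ + t * ⟪B w, w⟫ / 2 + θ * ‖w‖ ^ 2 := by field_simp
  linarith

lemma SubJet.const_mul {t : ℝ} (ht : 0 < t) (h : SubJet u x p B) :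
    SubJet (fun y => t * u y) x (t • p) (t • B) := by
  have e : -(t • -B) = t • B := by ext; simp
  have := (h.neg.const_mul ht).neg
  rw [e] at this
  simpa using this

lemma HasJet.const_mul {t : ℝ} (ht : 0 < t) (h : HasJet u x p B) :
    HasJet (fun y => t * u y) x (t • p) (t • B) := ⟨h.1.const_mul ht, h.2.const_mul ht⟩

lemma SupJet.mono (h : SupJet f x p B) (hle : ∀ᶠ z in 𝓝 x, u z - u x ≤ f z - f x) :
    SupJet u x p B := by
  have ht : Tendsto (fun w : E => x + w) (𝓝 0) (𝓝 x) := by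
    have : Tendsto (fun w : E => x + w) (𝓝 0) (𝓝 (x + 0)) := (continuous_const_add x).tendsto 0
    rwa [add_zero] at this
  intro θ hθ
  filter_upwards [h θ hθ, ht.eventually hle] with w h1 h2
  linarith

lemma SubJet.mono (h : SubJet f x p B) (hle : ∀ᶠ z in 𝓝 x, f z - f x ≤ u z - u x) :
    SubJet u x p B := by
  have := (h.neg.mono (u := fun y => -u y) (by
    filter_upwards [hle] with z hz; linarith)).neg
  have e : -(-B) = B := by ext; simp
  rw [e] at this
  simpa using this

lemma HasJet.congr (h : HasJet f x p B) (hle : ∀ᶠ z in 𝓝 x, u z - u x = f z - f x) :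
    HasJet u x p B :=
  ⟨h.1.mono (hle.mono fun _ hz => hz.le), h.2.mono (hle.mono fun _ hz => hz.ge)⟩

lemma SupJet.le_of_subJet (h : SupJet u x p B) (h' : SubJet u x q C) :
    q = p ∧ ∀ v, ⟪C v, v⟫ ≤ ⟪B v, v⟫ := by
  have key : ∀ θ > 0, ∀ᶠ w in 𝓝 (0 : E), ⟪q - p, w⟫ + ⟪(C - B) w, w⟫ / 2 ≤ θ * ‖w‖ ^ 2 := by
    intro θ hθ
    filter_upwards [h (θ / 2) (by positivity), h' (θ / 2) (by positivity)] with w h1 h2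
    simp only [_root_.sub_apply, inner_sub_left]
    linarith
  have hline : ∀ v : E, Tendsto (fun t : ℝ => t • v) (𝓝[>] 0) (𝓝 0) := by
    intro v
    have : Tendsto (fun t : ℝ => t • v) (𝓝 0) (𝓝 ((0 : ℝ) • v)) := tendsto_id.smul_const v
    rw [zero_smul] at this
    exact this.mono_left nhdsWithin_le_nhds
  have hp : ∀ v, ⟪q - p, v⟫ ≤ 0 := by
    intro v
    have hl : Tendsto (fun t : ℝ => t * (‖v‖ ^ 2 - ⟪(C - B) v, v⟫ / 2)) (𝓝[>] 0) (𝓝 0) := by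
      have : Tendsto (fun t : ℝ => t * (‖v‖ ^ 2 - ⟪(C - B) v, v⟫ / 2)) (𝓝 0)
        (𝓝 (0 * (‖v‖ ^ 2 - ⟪(C - B) v, v⟫ / 2))) := tendsto_id.mul_const _
      rw [zero_mul] at this
      exact this.mono_left nhdsWithin_le_nhds
    refine ge_of_tendsto hl ?_
    filter_upwards [(hline v).eventually (key 1 one_pos), self_mem_nhdsWithin] with t h1 ht
    replace ht : 0 < t := ht
    simp only [map_smul, real_inner_smul_left, real_inner_smul_right, norm_smul, mul_pow,
      Real.norm_eq_abs, sq_abs]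
      at h1
    have : t * ⟪q - p, v⟫ ≤ t * (t * (‖v‖ ^ 2 - ⟪(C - B) v, v⟫ / 2)) := by linarith
    exact le_of_mul_le_mul_left this ht
  have hpq : q = p := by
    have h1 := hp (q - p)
    rw [real_inner_self_nonpos, sub_eq_zero] at h1
    exact h1
  refine ⟨hpq, fun v => ?_⟩
  have := nonpos_of_homogeneous (q := fun w => ⟪(C - B) w, w⟫ / 2) (by
    intro t w
    simp only [map_smul, real_inner_smul_left, real_inner_smul_right]
    ring) (by
    intro θ hθ
    filter_upwards [key θ hθ] with w hw
    rw [hpq, sub_self, inner_zero_left] at hw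
    simpa using hw) v
  simp only [_root_.sub_apply, inner_sub_left] at this
  linarith

/-- The jet of a quadratic polynomial. -/
lemma hasJet_quadratic [CompleteSpace E] (c : ℝ) (a x p : E) (B : E →L[ℝ] E) :
    ∃ q, HasJet (fun y => c + ⟪p, y - a⟫ + ⟪B (y - a), y - a⟫ / 2) x q B := by
  refine ⟨p + (1 / 2 : ℝ) • (B (x - a) + B.adjoint (x - a)), ?_, ?_⟩ <;>
  · intro θ hθ
    refine Eventually.of_forall fun w => ?_
    have e : x + w - a = (x - a) + w := by abel
    have : 0 ≤ θ * ‖w‖ ^ 2 := by positivity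
    have e2 : ⟪B w, x - a⟫ = ⟪B.adjoint (x - a), w⟫ := by
      rw [ContinuousLinearMap.adjoint_inner_left, real_inner_comm]
    simp only [e, map_add, inner_add_left, inner_add_right, real_inner_smul_left, e2]
    linarith

lemma hasJet_norm_sub_sq (a x : E) :
    HasJet (fun y => ‖y - a‖ ^ 2) x ((2 : ℝ) • (x - a)) ((2 : ℝ) • ContinuousLinearMap.id ℝ E) := by
  have key : ∀ w, ‖x + w - a‖ ^ 2 = ‖x - a‖ ^ 2 + ⟪(2 : ℝ) • (x - a), w⟫
      + ⟪((2 : ℝ) • ContinuousLinearMap.id ℝ E) w, w⟫ / 2 := by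
    intro w
    have e : x + w - a = (x - a) + w := by abel
    simp only [smul_apply, real_inner_smul_left, ContinuousLinearMap.id_apply,
      real_inner_self_eq_norm_sq]
    rw [e, norm_add_sq_real]
    ring
  constructor <;>
  · intro θ hθ
    refine Eventually.of_forall fun w => ?_
    have : 0 ≤ θ * ‖w‖ ^ 2 := by positivity
    simp only [key]
    linarith

/-- The rank-one operator `v ↦ ⟪p, v⟫ p`. -/
def tensorSq (p : E) : E →L[ℝ] E := (innerSL ℝ p).smulRight p

lemma inner_tensorSq (p v : E) : ⟪tensorSq p v, v⟫ = ⟪p, v⟫ ^ 2 := by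
  change ⟪⟪p, v⟫ • p, v⟫ = _
  rw [real_inner_smul_left, sq]

lemma continuous_tensorSq : Continuous (tensorSq : E → E →L[ℝ] E) := by
  unfold tensorSq
  fun_prop

lemma HasJet.abs_le (h : HasJet f x p B) {θ : ℝ} (hθ : 0 < θ) :
    ∀ᶠ w in 𝓝 (0 : E), |f (x + w) - f x - ⟪p, w⟫ - ⟪B w, w⟫ / 2| ≤ θ * ‖w‖ ^ 2 := by
  filter_upwards [h.1 θ hθ, h.2 θ hθ] with w h1 h2
  rw [_root_.abs_le]
  constructor <;> linarith

lemma hasJet_of_abs_le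
    (h : ∀ θ > 0, ∀ᶠ w in 𝓝 (0 : E), |f (x + w) - f x - ⟪p, w⟫ - ⟪B w, w⟫ / 2| ≤ θ * ‖w‖ ^ 2) :
    HasJet f x p B := by
  constructor <;>
  · intro θ hθ
    filter_upwards [h θ hθ] with w hw
    have := _root_.abs_le.1 hw
    linarith [this.1, this.2]

lemma HasJet.sq_increment (h : HasJet f x p B) :
    HasJet (fun y => (f y - f x) ^ 2) x 0 ((2 : ℝ) • tensorSq p) := by
  apply hasJet_of_abs_le
  intro θ hθ
  set M := ‖B‖ / 2 + 1 with hM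
  have hM1 : 1 ≤ M := by have := norm_nonneg B; rw [hM]; linarith
  set r := min 1 (θ / (M * (M + 2 * ‖p‖))) with hr
  have hpos : 0 < M * (M + 2 * ‖p‖) := by have := norm_nonneg p; positivity
  have hr0 : 0 < r := lt_min one_pos (by positivity)
  filter_upwards [h.abs_le one_pos, Metric.ball_mem_nhds (0 : E) hr0] with w hw hwr
  rw [mem_ball_zero_iff] at hwr
  have hw1 : ‖w‖ < 1 := hwr.trans_le (min_le_left _ _)
  have hw2 : ‖w‖ * (M * (M + 2 * ‖p‖)) ≤ θ :=
    (le_div_iff₀ hpos).1 (hwr.le.trans (min_le_right _ _))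
  have hB : |⟪B w, w⟫| ≤ ‖B‖ * ‖w‖ ^ 2 := by
    have h1 := abs_real_inner_le_norm (B w) w
    have h2 := mul_le_mul_of_nonneg_right (B.le_opNorm w) (norm_nonneg w)
    nlinarith
  have hp : |⟪p, w⟫| ≤ ‖p‖ * ‖w‖ := abs_real_inner_le_norm p w
  have h1 : |f (x + w) - f x - ⟪p, w⟫| ≤ M * ‖w‖ ^ 2 := by
    have : f (x + w) - f x - ⟪p, w⟫
        = (f (x + w) - f x - ⟪p, w⟫ - ⟪B w, w⟫ / 2) + ⟪B w, w⟫ / 2 := by ring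
    rw [this]
    refine (abs_add_le _ _).trans ?_
    rw [abs_div, abs_two, hM]
    linarith
  have h2 : |f (x + w) - f x + ⟪p, w⟫| ≤ (M + 2 * ‖p‖) * ‖w‖ := by
    have : f (x + w) - f x + ⟪p, w⟫ = (f (x + w) - f x - ⟪p, w⟫) + 2 * ⟪p, w⟫ := by ring
    rw [this]
    refine (abs_add_le _ _).trans ?_
    rw [abs_mul, abs_two]
    have := norm_nonneg w
    have : M * ‖w‖ ^ 2 ≤ M * ‖w‖ := by
      have : ‖w‖ ^ 2 ≤ ‖w‖ := by nlinarith
      exact mul_le_mul_of_nonneg_left this (by linarith)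
    linarith
  have e : (f (x + w) - f x) ^ 2 - (f x - f x) ^ 2 - ⟪(0 : E), w⟫
      - ⟪((2 : ℝ) • tensorSq p) w, w⟫ / 2
      = (f (x + w) - f x - ⟪p, w⟫) * (f (x + w) - f x + ⟪p, w⟫) := by
    simp only [inner_zero_left, smul_apply, real_inner_smul_left, inner_tensorSq]
    ring
  rw [e, abs_mul]
  calc _ ≤ (M * ‖w‖ ^ 2) * ((M + 2 * ‖p‖) * ‖w‖) :=
        mul_le_mul h1 h2 (abs_nonneg _) (by positivity)
    _ = (‖w‖ * (M * (M + 2 * ‖p‖))) * ‖w‖ ^ 2 := by ring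
    _ ≤ θ * ‖w‖ ^ 2 := by gcongr

/-- The Hessian of `f` at `x`, as an operator. -/
def hessOp [CompleteSpace E] (f : E → ℝ) (x : E) : E →L[ℝ] E := fderiv ℝ (gradient f) x

lemma contDiffAt_gradient [CompleteSpace E] (h : ContDiffAt ℝ 2 f x) :
    ContDiffAt ℝ 1 (gradient f) x := by
  have h1 : ContDiffAt ℝ 1 (fderiv ℝ f) x := h.fderiv_right (m := 1) (by norm_num)
  let L : (E →L[ℝ] ℝ) →L[ℝ] E := LinearMap.mkContinuous
    { toFun := (InnerProductSpace.toDual ℝ E).symm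
      map_add' := map_add _
      map_smul' := fun t p => by simp } 1 fun p => by simp
  exact L.contDiff.contDiffAt.comp x h1

lemma inner_gradient [CompleteSpace E] (f : E → ℝ) (x w : E) :
    ⟪gradient f x, w⟫ = fderiv ℝ f x w := by
  simp [gradient]

lemma inner_hessOp [CompleteSpace E] (h : ContDiffAt ℝ 2 f x) (v w : E) :
    ⟪hessOp f x v, w⟫ = fderiv ℝ (fderiv ℝ f) x v w := by
  have h1 : ContDiffAt ℝ 1 (fderiv ℝ f) x := h.fderiv_right (m := 1) (by norm_num)
  have h2 := (h1.differentiableAt (by norm_num)).hasFDerivAt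
  have h3 := ((contDiffAt_gradient h).differentiableAt (by norm_num)).hasFDerivAt
  have h4 : HasFDerivAt (fun y => ⟪gradient f y, w⟫) _ x := h3.inner ℝ (hasFDerivAt_const w x)
  have h5 : HasFDerivAt (fun y => fderiv ℝ f y w) _ x := h2.clm_apply (hasFDerivAt_const w x)
  simp only [inner_gradient] at h4
  have h6 := DFunLike.congr_fun (h4.unique h5) v
  simpa [hessOp] using h6

/-- The second-order Taylor expansion of a `C²` function. -/
lemma hasJet_of_contDiffAt [CompleteSpace E] (h : ContDiffAt ℝ 2 f x) :
    HasJet f x (gradient f x) (hessOp f x) := by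
  have hsymm' : IsSymmSndFDerivAt ℝ f x := h.isSymmSndFDerivAt (by simp)
  set B := hessOp f x with hB
  have hsymm : ∀ v w, ⟪B v, w⟫ = ⟪B w, v⟫ := by
    intro v w
    rw [hB, inner_hessOp h, inner_hessOp h, hsymm']
  have h2 : HasFDerivAt (gradient f) B x :=
    ((contDiffAt_gradient h).differentiableAt (by norm_num)).hasFDerivAt
  have h3 : ∀ᶠ y in 𝓝 x, DifferentiableAt ℝ f y :=
    (h.eventually (by simp)).mono fun y hy => hy.differentiableAt (by norm_num)
  apply hasJet_of_abs_le
  intro θ hθ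
  have h4 := h2.isLittleO.def hθ
  obtain ⟨r, hr, hball⟩ := Metric.eventually_nhds_iff_ball.1 (h4.and h3)
  filter_upwards [Metric.ball_mem_nhds (0 : E) hr] with w hw
  rw [mem_ball_zero_iff] at hw
  set G : E → ℝ := fun y => f y - ⟪gradient f x, y - x⟫ - ⟪B (y - x), y - x⟫ / 2 with hG
  have hder : ∀ y ∈ Metric.closedBall x ‖w‖, HasFDerivWithinAt G
      (innerSL ℝ (gradient f y - gradient f x - B (y - x))) (Metric.closedBall x ‖w‖) y := by
    intro y hy
    have hy' : y ∈ Metric.ball x r := Metric.closedBall_subset_ball hw hy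
    have d0 : HasFDerivAt (fun y : E => y - x) (ContinuousLinearMap.id ℝ E) y :=
      (hasFDerivAt_id y).sub_const x
    have d1 := (hball y hy').2.hasFDerivAt
    have d2 : HasFDerivAt (fun y => ⟪gradient f x, y - x⟫) _ y :=
      (hasFDerivAt_const (gradient f x) y).inner ℝ d0
    have d3 : HasFDerivAt (fun y => ⟪B (y - x), y - x⟫) _ y :=
      (B.hasFDerivAt.comp y d0).inner ℝ d0
    have d4 := (d1.sub d2).sub (d3.mul_const (1 / 2 : ℝ))
    have e1 : G = fun y => f y - ⟪gradient f x, y - x⟫ - ⟪B (y - x), y - x⟫ * (1 / 2) := by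
      ext y; simp only [hG]; ring
    rw [e1]
    refine (d4.congr_fderiv ?_).hasFDerivWithinAt
    ext v
    have := hsymm v (y - x)
    simp [inner_sub_left, real_inner_comm] at this ⊢
    linarith
  have hbd : ∀ y ∈ Metric.closedBall x ‖w‖,
      ‖innerSL ℝ (gradient f y - gradient f x - B (y - x))‖ ≤ θ * ‖w‖ := by
    intro y hy
    have hy' : y ∈ Metric.ball x r := Metric.closedBall_subset_ball hw hy
    rw [innerSL_apply_norm]
    refine (hball y hy').1.trans ?_
    rw [mem_closedBall_iff_norm] at hy
    gcongr
  have := (convex_closedBall x ‖w‖).norm_image_sub_le_of_norm_hasFDerivWithin_le hder hbd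
    (Metric.mem_closedBall_self (norm_nonneg w)) (y := x + w) (by simp)
  simp only [hG, add_sub_cancel_left, sub_self, map_zero, inner_zero_right, Real.norm_eq_abs]
    at this
  calc _ = |f (x + w) - ⟪gradient f x, w⟫ - ⟪B w, w⟫ / 2 - (f x - 0 - 0 / 2)| := by
        congr 1; ring
    _ ≤ θ * ‖w‖ * ‖w‖ := this
    _ = θ * ‖w‖ ^ 2 := by ring

end Jets

section FormSets

open scoped RealInnerProductSpace

variable {E : Type*} [NormedAddCommGroup E] [InnerProductSpace ℝ E]

/-- A closed set of operators which is upward closed for the order of quadratic forms. -/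
structure IsSubeq (G : Set (E →L[ℝ] E)) : Prop where
  closed : IsClosed G
  mono : ∀ B ∈ G, ∀ C : E →L[ℝ] E, (∀ v, ⟪B v, v⟫ ≤ ⟪C v, v⟫) → C ∈ G

/-- The dual of a set of operators. -/
def dualForms (G : Set (E →L[ℝ] E)) : Set (E →L[ℝ] E) := {B | -B ∉ interior G}

variable {G : Set (E →L[ℝ] E)} {B C : E →L[ℝ] E}

lemma IsSubeq.interior_mono (hG : IsSubeq G) (hB : B ∈ interior G) (h : ∀ v, ⟪B v, v⟫ ≤ ⟪C v, v⟫) :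
    C ∈ interior G := by
  rw [mem_interior_iff_mem_nhds] at hB ⊢
  have : Tendsto (fun D => D - (C - B)) (𝓝 C) (𝓝 B) := by
    have h1 : Continuous (fun D : E →L[ℝ] E => D - (C - B)) := by fun_prop
    have := h1.tendsto C
    rwa [sub_sub_cancel] at this
  filter_upwards [this hB] with D hD
  refine hG.mono _ hD _ fun v => ?_
  simp only [_root_.sub_apply, inner_sub_left]
  linarith [h v]

lemma IsSubeq.add_mem_interior (hG : IsSubeq G) (hB : B ∈ G) {ε : ℝ} (hε : 0 < ε) :
    B + ε • ContinuousLinearMap.id ℝ E ∈ interior G := by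
  rw [mem_interior_iff_mem_nhds]
  filter_upwards [Metric.ball_mem_nhds _ hε] with D hD
  refine hG.mono _ hB _ fun v => ?_
  rw [mem_ball_iff_norm] at hD
  have h1 := abs_real_inner_le_norm ((D - (B + ε • ContinuousLinearMap.id ℝ E)) v) v
  have h2 : ‖(D - (B + ε • ContinuousLinearMap.id ℝ E)) v‖ * ‖v‖ ≤ ε * ‖v‖ ^ 2 := by
    rw [sq, ← mul_assoc]
    gcongr
    refine (ContinuousLinearMap.le_opNorm _ _).trans ?_
    gcongr
  have h3 := (abs_le.1 (h1.trans h2)).1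
  simp only [_root_.sub_apply, add_apply, smul_apply, ContinuousLinearMap.id_apply,
    inner_sub_left, inner_add_left, real_inner_smul_left, real_inner_self_eq_norm_sq] at h3
  linarith

lemma IsSubeq.dual (hG : IsSubeq G) : IsSubeq (dualForms G) where
  closed := by
    have : dualForms G = (fun B => -B) ⁻¹' (interior G)ᶜ := rfl
    rw [this]
    exact isOpen_interior.isClosed_compl.preimage continuous_neg
  mono := by
    intro B hB C h hC
    refine hB (hG.interior_mono hC fun v => ?_)
    simp only [neg_apply, inner_neg_left]
    linarith [h v]

lemma IsSubeq.eventually_mem_of_add (hG : IsSubeq G)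
    (h : ∀ θ > (0 : ℝ), B + θ • ContinuousLinearMap.id ℝ E ∈ G) : B ∈ G := by
  have : Tendsto (fun θ : ℝ => B + θ • ContinuousLinearMap.id ℝ E) (𝓝[>] 0) (𝓝 B) := by
    have h1 : Continuous (fun θ : ℝ => B + θ • ContinuousLinearMap.id ℝ E) := by fun_prop
    have := h1.tendsto 0
    rw [zero_smul, add_zero] at this
    exact this.mono_left nhdsWithin_le_nhds
  exact hG.closed.mem_of_tendsto this (eventually_mem_nhdsWithin.mono fun θ hθ => h θ hθ)

/-- Viscosity subsolutions, phrased with superjets. -/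
def JSub (G : Set (E →L[ℝ] E)) (W : Set E) (u : E → ℝ) : Prop :=
  UpperSemicontinuousOn u W ∧ ∀ x ∈ W, ∀ p B, SupJet u x p B → B ∈ G

end FormSets

section Matrices

open scoped RealInnerProductSpace

/-- The symmetric matrix of the symmetrization of a bilinear form. -/
def toSym (B : EucSp n →L[ℝ] EucSp n) : SymMat n :=
  ⟨Matrix.of fun i j => (⟪B (EuclideanSpace.single i 1), EuclideanSpace.single j 1⟫
    + ⟪B (EuclideanSpace.single j 1), EuclideanSpace.single i 1⟫) / 2, by
    rw [selfAdjoint.mem_iff]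
    ext i j
    simp [Matrix.star_apply, add_comm]⟩

lemma toSym_apply (B : EucSp n →L[ℝ] EucSp n) (i j : Fin n) :
    (toSym B).1 i j = (⟪B (EuclideanSpace.single i 1), EuclideanSpace.single j 1⟫
    + ⟪B (EuclideanSpace.single j 1), EuclideanSpace.single i 1⟫) / 2 := rfl

lemma continuous_toSym : Continuous (toSym (n := n)) := by
  refine Continuous.subtype_mk ?_ _
  refine continuous_matrix fun i j => ?_
  simp only [Matrix.of_apply]
  fun_prop

lemma toSym_add (B C : EucSp n →L[ℝ] EucSp n) : toSym (B + C) = toSym B + toSym C := by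
  apply Subtype.ext
  ext i j
  simp only [toSym_apply, add_apply, inner_add_left, AddSubgroup.coe_add, Matrix.add_apply]
  ring

lemma toSym_smul (t : ℝ) (B : EucSp n →L[ℝ] EucSp n) : toSym (t • B) = t • toSym B := by
  apply Subtype.ext
  ext i j
  simp only [toSym_apply, smul_apply, real_inner_smul_left, selfAdjoint.val_smul,
    Matrix.smul_apply, smul_eq_mul]
  ring

lemma toSym_neg (B : EucSp n →L[ℝ] EucSp n) : toSym (-B) = -toSym B := by
  have h1 : -B = (-1 : ℝ) • B := by ext; simp
  rw [h1, toSym_smul, neg_one_smul]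

lemma sum_single (v : EucSp n) : v = ∑ i, v i • EuclideanSpace.single i (1 : ℝ) := by
  ext j
  simp [Pi.single_apply]

lemma form_apply_eq_sum (B : EucSp n →L[ℝ] EucSp n) (v : EucSp n) :
    ⟪B v, v⟫ = ∑ i, ∑ j, v i * v j * (toSym B).1 i j := by
  have h1 : ⟪B v, v⟫ = ∑ i, ∑ j,
      v i * v j * ⟪B (EuclideanSpace.single i 1), EuclideanSpace.single j 1⟫ := by
    conv_lhs => rw [sum_single v]
    simp only [map_sum, map_smul, sum_inner, inner_sum, real_inner_smul_left,
      real_inner_smul_right]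
    rw [Finset.sum_comm]
    refine Finset.sum_congr rfl fun i _ => Finset.sum_congr rfl fun j _ => by ring
  have h2 : ⟪B v, v⟫ = ∑ i, ∑ j,
      v i * v j * ⟪B (EuclideanSpace.single j 1), EuclideanSpace.single i 1⟫ := by
    rw [h1, Finset.sum_comm]
    refine Finset.sum_congr rfl fun i _ => Finset.sum_congr rfl fun j _ => by ring
  have h3 : ⟪B v, v⟫ = (⟪B v, v⟫ + ⟪B v, v⟫) / 2 := by ring
  rw [h3]
  nth_rewrite 1 [h1]
  rw [h2, ← Finset.sum_add_distrib, Finset.sum_div]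
  refine Finset.sum_congr rfl fun i _ => ?_
  rw [← Finset.sum_add_distrib, Finset.sum_div]
  refine Finset.sum_congr rfl fun j _ => ?_
  rw [toSym_apply]
  ring

lemma toSym_posSemidef {P : EucSp n →L[ℝ] EucSp n} (h : ∀ v, 0 ≤ ⟪P v, v⟫) :
    (toSym P : Matrix (Fin n) (Fin n) ℝ).PosSemidef := by
  rw [Matrix.posSemidef_iff_dotProduct_mulVec]
  refine ⟨(toSym P).2, fun v => ?_⟩
  have := h (WithLp.toLp 2 v)
  rw [form_apply_eq_sum] at this
  simpa [dotProduct, Matrix.mulVec, Finset.mul_sum, mul_assoc, mul_comm, mul_left_comm] using this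

/-- The bilinear form of a symmetric matrix. -/
def formOf (A : SymMat n) : EucSp n →L[ℝ] EucSp n :=
  ∑ i, ∑ j, A.1 i j • (EuclideanSpace.proj (𝕜 := ℝ) i : EucSp n →L[ℝ] ℝ).smulRight
    (EuclideanSpace.single j (1 : ℝ))

lemma continuous_formOf : Continuous (formOf (n := n)) := by
  unfold formOf
  refine continuous_finsetSum _ fun i _ => continuous_finsetSum _ fun j _ => ?_
  have : Continuous fun A : SymMat n => A.1 i j :=
    (continuous_subtype_val.matrix_elem i j)
  exact this.smul continuous_const

lemma formOf_apply (A : SymMat n) (v w : EucSp n) :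
    ⟪formOf A v, w⟫ = ∑ i, ∑ j, A.1 i j * (v i * w j) := by
  simp [formOf, _root_.sum_apply, sum_inner, real_inner_smul_left, EuclideanSpace.inner_single_left]

lemma toSym_formOf (A : SymMat n) : toSym (formOf A) = A := by
  apply Subtype.ext
  ext i j
  have h := congrFun (congrFun (A.2 : star A.1 = A.1) i) j
  simp only [Matrix.star_apply, star_trivial] at h
  rw [toSym_apply, formOf_apply, formOf_apply]
  simp [h]

/-- The set of operators corresponding to a set of symmetric matrices. -/
def formSet (S : Set (SymMat n)) : Set (EucSp n →L[ℝ] EucSp n) := toSym ⁻¹' S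

lemma interior_formSet (S : Set (SymMat n)) : interior (formSet S) = formSet (interior S) := by
  apply subset_antisymm
  · intro B hB
    rw [mem_interior_iff_mem_nhds] at hB
    change toSym B ∈ interior S
    rw [mem_interior_iff_mem_nhds]
    have hc : Continuous fun A : SymMat n => B + formOf A - formOf (toSym B) :=
      (continuous_const.add continuous_formOf).sub continuous_const
    have ht := hc.tendsto (toSym B)
    rw [add_sub_cancel_right] at ht
    filter_upwards [ht hB] with A hA
    have hA' : toSym (B + formOf A - formOf (toSym B)) ∈ S := hA
    rwa [sub_eq_add_neg, toSym_add, toSym_add, toSym_neg, toSym_formOf, toSym_formOf,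
      add_neg_cancel_comm] at hA'
  · exact preimage_interior_subset_interior_preimage continuous_toSym

lemma formSet_dualSet (S : Set (SymMat n)) : formSet (dualSet S) = dualForms (formSet S) := by
  ext B
  change -toSym B ∉ interior S ↔ -B ∉ interior (formSet S)
  rw [interior_formSet]
  change _ ↔ toSym (-B) ∉ interior S
  rw [toSym_neg]

lemma ConeSubequation.isSubeq (F : ConeSubequation n) : IsSubeq (formSet F.carrier) where
  closed := F.isClosed'.preimage continuous_toSym
  mono := by
    intro B hB C h
    have h1 := F.f1 _ hB (toSym (C - B)) (toSym_posSemidef fun v => by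
      simpa [inner_sub_left] using h v)
    rw [← toSym_add, add_sub_cancel] at h1
    exact h1

lemma ConeSubequation.smul_mem (F : ConeSubequation n) {B : EucSp n →L[ℝ] EucSp n}
    (hB : B ∈ formSet F.carrier) {t : ℝ} (ht : 0 < t) : t • B ∈ formSet F.carrier := by
  change toSym _ ∈ F.carrier
  rw [toSym_smul]
  exact F.f2 _ hB t ht

lemma hessMatrix_eq {ψ : EucSp n → ℝ} {x : EucSp n} (h : ContDiffAt ℝ 2 ψ x) :
    hessMatrix ψ x = (toSym (hessOp ψ x) : Matrix (Fin n) (Fin n) ℝ) := by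
  have hsymm : IsSymmSndFDerivAt ℝ ψ x := h.isSymmSndFDerivAt (by simp)
  ext i j
  rw [toSym_apply, inner_hessOp h, inner_hessOp h, hsymm (EuclideanSpace.single j 1)]
  simp [hessMatrix, iteratedFDeriv_two_apply]

lemma hessMatrix_mem_iff {S : Set (SymMat n)} {ψ : EucSp n → ℝ} {x : EucSp n}
    (h : ContDiffAt ℝ 2 ψ x) :
    hessMatrix ψ x ∈ Subtype.val '' S ↔ hessOp ψ x ∈ formSet S := by
  rw [hessMatrix_eq h, Subtype.val_injective.mem_set_image]
  rfl

lemma fSubharmonicOn_coe_iff {S : Set (SymMat n)} (hS : IsSubeq (formSet S)) {W : Set (EucSp n)}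
    (hW : IsOpen W) {u : EucSp n → ℝ} :
    FSubharmonicOn S W (fun y => (u y : EReal)) ↔ JSub (formSet S) W u := by
  have husc : UpperSemicontinuousOn (fun y => (u y : EReal)) W ↔ UpperSemicontinuousOn u W := by
    constructor
    · intro h x hx a ha
      filter_upwards [h x hx a (EReal.coe_lt_coe_iff.2 ha)] with z hz
      exact EReal.coe_lt_coe_iff.1 hz
    · intro h
      exact continuous_coe_real_ereal.comp_upperSemicontinuousOn h
        (fun a b hab => EReal.coe_le_coe_iff.2 hab)
  constructor
  · rintro ⟨h1, -, h3⟩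
    refine ⟨husc.1 h1, fun x hx p B hB => ?_⟩
    refine hS.eventually_mem_of_add fun θ hθ => ?_
    obtain ⟨q, hq⟩ := hasJet_quadratic (u x) x x p (B + θ • ContinuousLinearMap.id ℝ (EucSp n))
    set ψ : EucSp n → ℝ :=
      fun y => u x + ⟪p, y - x⟫
        + ⟪(B + θ • ContinuousLinearMap.id ℝ (EucSp n)) (y - x), y - x⟫ / 2 with hψ
    have hc : ContDiff ℝ 2 ψ := by
      have h1 : ContDiff ℝ 2 fun y : EucSp n => y - x := by fun_prop
      exact (contDiff_const.add (contDiff_const.inner ℝ h1)).add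
        ((((B + θ • ContinuousLinearMap.id ℝ (EucSp n)).contDiff.comp h1).inner ℝ h1).div_const 2)
    have htest : IsTestAt W (fun y => (u y : EReal)) ψ x := by
      refine ⟨hc.contDiffAt, ?_, by simp [hψ]⟩
      have ht : Tendsto (fun y : EucSp n => y - x) (𝓝 x) (𝓝 0) := by
        have : Continuous (fun y : EucSp n => y - x) := by fun_prop
        simpa using this.tendsto x
      refine nhdsWithin_le_nhds ?_
      filter_upwards [ht.eventually (hB (θ / 2) (by positivity))] with y hy
      rw [add_sub_cancel] at hy
      rw [EReal.coe_le_coe_iff]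
      simp only [hψ, add_apply, smul_apply, ContinuousLinearMap.id_apply, inner_add_left,
        real_inner_smul_left, real_inner_self_eq_norm_sq]
      linarith
    have hm := (hessMatrix_mem_iff hc.contDiffAt).1 (h3 x hx ψ htest)
    have hj := hasJet_of_contDiffAt (hc.contDiffAt (x := x))
    exact hS.mono _ hm _ (hq.1.le_of_subJet hj.2).2
  · rintro ⟨h1, h2⟩
    refine ⟨husc.2 h1, fun x _ => EReal.coe_ne_top _, fun x hx ψ hψ => ?_⟩
    obtain ⟨hc, hle, heq⟩ := hψ
    rw [hW.nhdsWithin_eq hx] at hle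
    rw [hessMatrix_mem_iff hc]
    refine h2 x hx _ _ ((hasJet_of_contDiffAt hc).1.mono ?_)
    filter_upwards [hle] with z hz
    rw [EReal.coe_le_coe_iff] at hz
    rw [EReal.coe_eq_coe_iff] at heq
    linarith

lemma FSubharmonicOn.congr {S : Set (SymMat n)} {W : Set (EucSp n)} {u v : EucSp n → EReal}
    (hu : FSubharmonicOn S W u) (h : Set.EqOn u v W) : FSubharmonicOn S W v := by
  refine ⟨fun x hx a ha => ?_, fun x hx => h hx ▸ hu.2.1 x hx, fun x hx ψ hψ => ?_⟩
  · filter_upwards [hu.1 x hx a (by simpa only [h hx] using ha), self_mem_nhdsWithin] with z hz hzW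
    rwa [← h hzW]
  · refine hu.2.2 x hx ψ ⟨hψ.1, ?_, by rw [h hx]; exact hψ.2.2⟩
    filter_upwards [hψ.2.1, self_mem_nhdsWithin] with z hz hzW
    rwa [h hzW]

end Matrices

section Comparison

open scoped RealInnerProductSpace

variable {E : Type*} [NormedAddCommGroup E] [InnerProductSpace ℝ E]

lemma isCompact_superlevel [FiniteDimensional ℝ E] {W : Set E}
    (hWb : Bornology.IsBounded W) {f : E → ℝ} (hf : UpperSemicontinuousOn f W)
    {b b' : ℝ} (hbb' : b < b') (hb : ∀ x ∈ frontier W, ∀ᶠ z in 𝓝[W] x, f z ≤ b) :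
    IsCompact {x ∈ W | b' ≤ f x} := by
  have := FiniteDimensional.proper_real E
  refine Metric.isCompact_of_isClosed_isBounded ?_ (hWb.subset fun x hx => hx.1)
  refine isClosed_of_closure_subset fun x hx => ?_
  rw [mem_closure_iff_frequently] at hx
  have hx' : ∃ᶠ y in 𝓝[W] x, b' ≤ f y := by
    rw [frequently_nhdsWithin_iff]
    exact hx.mono fun y hy => ⟨hy.2, hy.1⟩
  have hcl : x ∈ closure W := mem_closure_iff_frequently.2 (hx.mono fun y hy => hy.1)
  by_cases hxW : x ∈ W
  · refine ⟨hxW, ?_⟩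
    by_contra hlt
    rw [not_le] at hlt
    exact hx' ((hf x hxW b' hlt).mono fun z hz => not_le.2 hz)
  · have hfr : x ∈ frontier W := ⟨hcl, fun h => hxW (interior_subset h)⟩
    exact absurd ((hb x hfr).mono fun z hz => not_le.2 (hz.trans_lt hbb')) hx'

/-- The convex part of the sup-convolution of an upper semicontinuous function on a compact set. -/
lemma exists_supConvolution {L : Set E} (hL : IsCompact L) (hne : L.Nonempty) {u : E → ℝ}
    (hu : UpperSemicontinuousOn u L) (μ : ℝ) :
    ∃ (f : E → ℝ) (Y : E → E), (∀ x, Y x ∈ L) ∧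
      (∀ x, f x = u (Y x) - μ / 2 * ‖Y x‖ ^ 2 + μ * ⟪x, Y x⟫) ∧
      (∀ x, ∀ y ∈ L, u y - μ / 2 * ‖y‖ ^ 2 + μ * ⟪x, y⟫ ≤ f x) ∧
      ∀ x, IsSubgrad f x (μ • Y x) := by
  have h : ∀ x : E, ∃ y ∈ L, ∀ z ∈ L, u z + (- μ / 2 * ‖z‖ ^ 2 + μ * ⟪x, z⟫) ≤
      u y + (- μ / 2 * ‖y‖ ^ 2 + μ * ⟪x, y⟫) := by
    intro x
    have hc : Continuous fun z : E => - μ / 2 * ‖z‖ ^ 2 + μ * ⟪x, z⟫ := by fun_prop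
    obtain ⟨y, hy, hmax⟩ := (hu.add
      (hc.upperSemicontinuous.upperSemicontinuousOn L)).exists_isMaxOn hne hL
    exact ⟨y, hy, fun z hz => hmax hz⟩
  choose Y hY hmax using h
  refine ⟨fun x => u (Y x) - μ / 2 * ‖Y x‖ ^ 2 + μ * ⟪x, Y x⟫, Y, hY, fun x => rfl, ?_, ?_⟩
  · intro x y hy
    have := hmax x y hy
    dsimp only
    linarith
  · intro x z
    have := hmax z (Y x) (hY x)
    dsimp only
    rw [real_inner_smul_left, inner_sub_right, real_inner_comm x, real_inner_comm z]
    linarith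

omit [InnerProductSpace ℝ E] in
lemma doubling {L : Set E} (hL : IsCompact L) {u v : E → ℝ} (hu : UpperSemicontinuousOn u L)
    (hv : UpperSemicontinuousOn v L) {m : ℝ} (hm : ∀ x ∈ L, m ≤ u x + v x → x ∈ interior L) :
    ∃ μ : ℝ, 0 < μ ∧ ∀ y ∈ L, ∀ z ∈ L, m ≤ u y + v z - μ / 4 * ‖y - z‖ ^ 2 →
      y ∈ interior L ∧ z ∈ interior L := by
  by_contra! hcon
  choose y hy z hz hyz hnot using fun k : ℕ => hcon (k + 1) (by positivity)
  obtain ⟨Mu, hMu⟩ := hu.bddAbove_of_isCompact hL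
  obtain ⟨Mv, hMv⟩ := hv.bddAbove_of_isCompact hL
  obtain ⟨⟨a, b⟩, hab, ϕ, hϕ, hlim⟩ :=
    (hL.prod hL).tendsto_subseq (x := fun k => (y k, z k)) fun k => ⟨hy k, hz k⟩
  have hya : Tendsto (fun k => y (ϕ k)) atTop (𝓝 a) := (continuous_fst.tendsto _).comp hlim
  have hzb : Tendsto (fun k => z (ϕ k)) atTop (𝓝 b) := (continuous_snd.tendsto _).comp hlim
  have hEq : a = b := by
    have h1 : Tendsto (fun k => ‖y (ϕ k) - z (ϕ k)‖ ^ 2) atTop (𝓝 (‖a - b‖ ^ 2)) :=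
      ((hya.sub hzb).norm).pow 2
    have h2 : Tendsto (fun k : ℕ => 4 * (Mu + Mv - m) * (1 / ((k : ℝ) + 1))) atTop (𝓝 0) := by
      simpa using tendsto_one_div_add_atTop_nhds_zero_nat.const_mul (4 * (Mu + Mv - m))
    have h3 : ‖a - b‖ ^ 2 ≤ 0 := by
      refine le_of_tendsto_of_tendsto' h1 (h2.comp hϕ.tendsto_atTop) fun k => ?_
      have e1 := hMu ⟨_, hy (ϕ k), rfl⟩
      have e2 := hMv ⟨_, hz (ϕ k), rfl⟩
      have e3 := hyz (ϕ k)
      have : (0 : ℝ) < (ϕ k : ℝ) + 1 := by positivity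
      simp only [Function.comp]
      rw [mul_one_div, le_div_iff₀ this]
      linarith
    have h4 : ‖a - b‖ = 0 := by nlinarith [norm_nonneg (a - b)]
    rwa [norm_eq_zero, sub_eq_zero] at h4
  subst hEq
  have hya' : Tendsto (fun k => y (ϕ k)) atTop (𝓝[L] a) :=
    tendsto_nhdsWithin_iff.2 ⟨hya, Eventually.of_forall fun k => hy _⟩
  have hzb' : Tendsto (fun k => z (ϕ k)) atTop (𝓝[L] a) :=
    tendsto_nhdsWithin_iff.2 ⟨hzb, Eventually.of_forall fun k => hz _⟩
  have hle : m ≤ u a + v a := by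
    by_contra! hlt
    set ε := (m - (u a + v a)) / 2 with hε
    have hε0 : 0 < ε := by rw [hε]; linarith
    have e1 := hya'.eventually (hu a hab.1 (u a + ε) (by simpa using hε0))
    have e2 := hzb'.eventually (hv a hab.1 (v a + ε) (by simpa using hε0))
    obtain ⟨k, k1, k2⟩ := (e1.and e2).exists
    have e3 := hyz (ϕ k)
    have : 0 ≤ ((ϕ k : ℝ) + 1) / 4 * ‖y (ϕ k) - z (ϕ k)‖ ^ 2 := by positivity
    linarith
  have hBint := isOpen_interior.mem_nhds (hm a hab.1 hle)
  obtain ⟨k, k1, k2⟩ := ((hya.eventually hBint).and (hzb.eventually hBint)).exists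
  exact hnot (ϕ k) k1 k2

lemma supJet_of_supConvolution {L : Set E} {u f : E → ℝ} {μ : ℝ} {x y : E}
    (hy : y ∈ interior L) (hfx : f x = u y - μ / 2 * ‖y‖ ^ 2 + μ * ⟪x, y⟫)
    (hf : ∀ x, ∀ y ∈ L, u y - μ / 2 * ‖y‖ ^ 2 + μ * ⟪x, y⟫ ≤ f x) {S : E →L[ℝ] E}
    (hS : ∀ θ > 0, ∀ᶠ w in 𝓝 (0 : E),
      |f (x + w) - f x - ⟪μ • y, w⟫ - ⟪S w, w⟫ / 2| ≤ θ * ‖w‖ ^ 2) :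
    SupJet u y (μ • (y - x)) (S - μ • ContinuousLinearMap.id ℝ E) := by
  intro θ hθ
  have ht : Tendsto (fun w : E => y + w) (𝓝 0) (𝓝 y) := by
    have : Tendsto (fun w : E => y + w) (𝓝 0) (𝓝 (y + 0)) := (continuous_const_add y).tendsto 0
    rwa [add_zero] at this
  filter_upwards [hS θ hθ, ht.eventually (mem_interior_iff_mem_nhds.1 hy)] with w h1 h2
  have h3 := (abs_le.1 h1).2
  have h4 := hf (x + w) (y + w) h2
  rw [norm_add_sq_real, inner_add_left, inner_add_right, inner_add_right,
    real_inner_self_eq_norm_sq, real_inner_comm y w] at h4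
  simp only [_root_.sub_apply, smul_apply, ContinuousLinearMap.id_apply, real_inner_smul_left,
    inner_sub_left, real_inner_self_eq_norm_sq] at h3 ⊢
  nlinarith

variable [FiniteDimensional ℝ E] {G : Set (E →L[ℝ] E)}

/-- The theorem on sums combined with doubling of variables: `u + v` has no strict interior
maximum set. -/
lemma JSub.false_of_interior_max (hG : IsSubeq G) {L : Set E} (hL : IsCompact L) {u v : E → ℝ}
    (hu : UpperSemicontinuousOn u L) (hv : UpperSemicontinuousOn v L)
    (huG : ∀ x ∈ interior L, ∀ p B, SupJet u x p B → B ∈ G)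
    (hvG : ∀ x ∈ interior L, ∀ p B, SupJet v x p B → B ∈ dualForms G)
    {m m' : ℝ} (hm : ∀ x ∈ L, m' ≤ u x + v x → x ∈ interior L) (hmm : m' < m)
    {x₁ : E} (hx₁ : x₁ ∈ L) (hx₁m : m ≤ u x₁ + v x₁) : False := by
  have := FiniteDimensional.proper_real E
  obtain ⟨μ, hμ, hclaim⟩ := doubling hL hu hv hm
  obtain ⟨f₁, Y₁, hY₁, hf₁, hle₁, hs₁⟩ := exists_supConvolution hL ⟨x₁, hx₁⟩ hu μ
  obtain ⟨f₂, Y₂, hY₂, hf₂, hle₂, hs₂⟩ := exists_supConvolution hL ⟨x₁, hx₁⟩ hv μ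
  obtain ⟨Mu, hMu⟩ := hu.bddAbove_of_isCompact hL
  obtain ⟨Mv, hMv⟩ := hv.bddAbove_of_isCompact hL
  obtain ⟨R₀, hR₀⟩ := hL.isBounded.exists_norm_le
  have hR₀0 : 0 ≤ R₀ := (norm_nonneg _).trans (hR₀ _ hx₁)
  have hup₁ : ∀ x, f₁ x ≤ Mu + μ * (‖x‖ * R₀) := by
    intro x
    have h1 := hMu ⟨_, hY₁ x, rfl⟩
    have h2 := real_inner_le_norm x (Y₁ x)
    have h3 := mul_le_mul_of_nonneg_left (hR₀ _ (hY₁ x)) (norm_nonneg x)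
    have h4 := mul_le_mul_of_nonneg_left (h2.trans h3) hμ.le
    have h5 : 0 ≤ μ / 2 * ‖Y₁ x‖ ^ 2 := by positivity
    rw [hf₁]; linarith
  have hup₂ : ∀ x, f₂ x ≤ Mv + μ * (‖x‖ * R₀) := by
    intro x
    have h1 := hMv ⟨_, hY₂ x, rfl⟩
    have h2 := real_inner_le_norm x (Y₂ x)
    have h3 := mul_le_mul_of_nonneg_left (hR₀ _ (hY₂ x)) (norm_nonneg x)
    have h4 := mul_le_mul_of_nonneg_left (h2.trans h3) hμ.le
    have h5 : 0 ≤ μ / 2 * ‖Y₂ x‖ ^ 2 := by positivity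
    rw [hf₂]; linarith
  have hcont : ∀ (f : E → ℝ) (Y : E → E), (∀ x, Y x ∈ L) → (∀ x, IsSubgrad f x (μ • Y x)) →
      Continuous f := by
    intro f Y hY hs
    have : LipschitzWith (Real.toNNReal (μ * R₀)) f := by
      refine LipschitzWith.of_le_add_mul _ fun x z => ?_
      have h1 := hs x z
      have h2 := real_inner_le_norm (μ • Y x) (x - z)
      have h3 : ⟪μ • Y x, z - x⟫ = -⟪μ • Y x, x - z⟫ := by rw [← inner_neg_right, neg_sub]
      have h4 : ‖μ • Y x‖ * ‖x - z‖ ≤ μ * R₀ * ‖x - z‖ := by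
        rw [norm_smul, Real.norm_of_nonneg hμ.le]
        have := hR₀ _ (hY x)
        gcongr
      rw [Real.coe_toNNReal _ (by positivity), dist_eq_norm]
      linarith
    exact this.continuous
  have hc₁ := hcont f₁ Y₁ hY₁ hs₁
  have hc₂ := hcont f₂ Y₂ hY₂ hs₂
  -- a radius containing all the maximum points
  obtain ⟨R₁, hR₁0, hR₁⟩ : ∃ R₁ : ℝ, 0 < R₁ ∧ ∀ r ≥ R₁,
      Mu + Mv + 2 * (μ * (r * R₀)) + r - μ / 2 * r ^ 2 < f₁ 0 + f₂ 0 := by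
    set c := 2 * μ * R₀ + 1 with hc
    set d := |Mu + Mv - (f₁ 0 + f₂ 0)| + 1 with hd
    have hd1 : Mu + Mv - (f₁ 0 + f₂ 0) < d := by
      have := le_abs_self (Mu + Mv - (f₁ 0 + f₂ 0)); linarith
    have hd0 : 1 ≤ d := by have := abs_nonneg (Mu + Mv - (f₁ 0 + f₂ 0)); linarith
    have hc0 : 1 ≤ c := by have : 0 ≤ 2 * μ * R₀ := by positivity
                           linarith
    refine ⟨1 + 2 / μ * (c + d), by positivity, fun r hr => ?_⟩
    have h1 : 2 / μ * (c + d) ≤ r := by linarith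
    have h2 : c + d ≤ μ / 2 * r := by
      have := mul_le_mul_of_nonneg_left h1 (by positivity : 0 ≤ μ / 2)
      calc c + d = μ / 2 * (2 / μ * (c + d)) := by field_simp
        _ ≤ _ := this
    have hr1 : 1 ≤ r := by
      have : 0 ≤ 2 / μ * (c + d) := by positivity
      linarith
    have h3 : (c + d) * r ≤ μ / 2 * r * r := by gcongr
    nlinarith
  have hA : 0 < ‖x₁‖ + R₁ := by positivity
  set δ := min 1 ((m - m') / (2 * (‖x₁‖ + R₁))) with hδ
  have hδ0 : 0 < δ := lt_min one_pos (div_pos (by linarith) (by positivity))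
  have hδ2 : δ * (‖x₁‖ + R₁) ≤ (m - m') / 2 := by
    have := (le_div_iff₀ (by positivity)).1 (min_le_right 1 ((m - m') / (2 * (‖x₁‖ + R₁))))
    rw [← hδ] at this
    linarith
  set η := min (μ / 2) ((m - m') / (2 * R₁ ^ 2)) with hη
  have hη0 : 0 < η := lt_min (by positivity) (div_pos (by linarith) (by positivity))
  have hη1 : η ≤ μ / 2 := min_le_left _ _
  have hη2 : η * R₁ ^ 2 ≤ (m - m') / 2 := by
    have := (le_div_iff₀ (by positivity)).1 (min_le_right (μ / 2) ((m - m') / (2 * R₁ ^ 2)))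
    rw [← hη] at this
    linarith
  have hk : 0 < μ - η := by linarith
  have hfar : ∀ p : E, ‖p‖ < δ → ∀ x, R₁ ≤ ‖x‖ →
      f₁ x + f₂ x - (μ - η) * ‖x‖ ^ 2 - ⟪p, x⟫ < f₁ 0 + f₂ 0 := by
    intro p hp x hx
    have h1 := hR₁ _ hx
    have h2 := (abs_le.1 (abs_real_inner_le_norm p x)).1
    have h3 : ‖p‖ * ‖x‖ ≤ 1 * ‖x‖ := by
      gcongr; exact hp.le.trans (min_le_left _ _)
    have h4 : μ / 2 * ‖x‖ ^ 2 ≤ (μ - η) * ‖x‖ ^ 2 := by gcongr; linarith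
    linarith [hup₁ x, hup₂ x]
  have hmax : ∀ p : E, ‖p‖ < δ → ∃ x, ∀ z,
      f₁ z + f₂ z - (μ - η) * ‖z‖ ^ 2 - ⟪p, z⟫ ≤ f₁ x + f₂ x - (μ - η) * ‖x‖ ^ 2 - ⟪p, x⟫ := by
    intro p hp
    have hc : Continuous fun z => f₁ z + f₂ z - (μ - η) * ‖z‖ ^ 2 - ⟪p, z⟫ := by fun_prop
    obtain ⟨x, hx, hxm⟩ := (isCompact_closedBall (0 : E) R₁).exists_isMaxOn
      ⟨0, Metric.mem_closedBall_self hR₁0.le⟩ hc.continuousOn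
    refine ⟨x, fun z => ?_⟩
    by_cases hz : z ∈ Metric.closedBall (0 : E) R₁
    · exact hxm hz
    · rw [mem_closedBall_zero_iff, not_le] at hz
      have h1 := hfar p hp z hz.le
      have h2 := hxm (Metric.mem_closedBall_self hR₁0.le : (0 : E) ∈ _)
      simp only [norm_zero, inner_zero_right, Set.mem_ofPred_eq] at h2
      linarith
  obtain ⟨p, x, hp, hx, hjets⟩ := exists_taylor_at_max (fun x => ⟨_, hs₁ x⟩) (fun x => ⟨_, hs₂ x⟩)
    hk hδ0 hmax
  obtain ⟨S₁, S₂, hS₁, hS₂, hsum⟩ := hjets _ _ (hs₁ x) (hs₂ x)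
  have hxR : ‖x‖ < R₁ := by
    by_contra! h
    have h1 := hfar p hp x h
    have h2 := hx 0
    simp only [norm_zero, inner_zero_right] at h2
    linarith
  have hval : m' ≤ u (Y₁ x) + v (Y₂ x) - μ / 4 * ‖Y₁ x - Y₂ x‖ ^ 2 := by
    have h1 := hx x₁
    have h2 := hle₁ x₁ x₁ hx₁
    have h3 := hle₂ x₁ x₁ hx₁
    rw [real_inner_self_eq_norm_sq] at h2 h3
    rw [hf₁ x, hf₂ x] at h1
    have h4 := (abs_le.1 (abs_real_inner_le_norm p x)).1
    have h5 := real_inner_le_norm p x₁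
    have h6 : ‖p‖ * ‖x‖ ≤ δ * R₁ := by gcongr
    have h7 : ‖p‖ * ‖x₁‖ ≤ δ * ‖x₁‖ := by gcongr
    have h8 : η * ‖x‖ ^ 2 ≤ η * R₁ ^ 2 := by gcongr
    have h9 : ‖Y₁ x - Y₂ x‖ ^ 2 ≤ 2 * (‖x - Y₁ x‖ ^ 2 + ‖x - Y₂ x‖ ^ 2) := by
      have e : Y₁ x - Y₂ x = (x - Y₂ x) - (x - Y₁ x) := by abel
      rw [e]
      have := norm_sub_le (x - Y₂ x) (x - Y₁ x)
      have h0 := norm_nonneg ((x - Y₂ x) - (x - Y₁ x))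
      nlinarith [sq_nonneg (‖x - Y₂ x‖ - ‖x - Y₁ x‖), norm_nonneg (x - Y₂ x),
        norm_nonneg (x - Y₁ x)]
    rw [norm_sub_sq_real, norm_sub_sq_real] at h9
    have h10 := mul_le_mul_of_nonneg_left h9 hμ.le
    have h11 : 0 ≤ η * ‖x₁‖ ^ 2 := by positivity
    rw [norm_sub_sq_real] at h10 ⊢
    nlinarith
  obtain ⟨hi₁, hi₂⟩ := hclaim _ (hY₁ x) _ (hY₂ x) hval
  have hj₁ := huG _ hi₁ _ _ (supJet_of_supConvolution hi₁ (hf₁ x) hle₁ hS₁)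
  have hj₂ := hvG _ hi₂ _ _ (supJet_of_supConvolution hi₂ (hf₂ x) hle₂ hS₂)
  refine hj₂ (hG.interior_mono (hG.add_mem_interior hj₁ (by positivity : 0 < 2 * η)) fun w => ?_)
  have := hsum w
  simp only [_root_.sub_apply, neg_apply, add_apply, smul_apply, ContinuousLinearMap.id_apply,
    inner_sub_left, inner_neg_left, inner_add_left, real_inner_smul_left,
    real_inner_self_eq_norm_sq]
  linarith

/-- The comparison principle on bounded open sets. -/
theorem JSub.comparison (hG : IsSubeq G) {W : Set E} (hW : IsOpen W)
    (hWb : Bornology.IsBounded W) {u v : E → ℝ} (hu : JSub G W u) (hv : JSub (dualForms G) W v)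
    {b : ℝ} (hb : ∀ x ∈ frontier W, ∀ᶠ z in 𝓝[W] x, u z + v z ≤ b) :
    ∀ x ∈ W, u x + v x ≤ b := by
  have := FiniteDimensional.proper_real E
  by_contra! h
  obtain ⟨x₁, hx₁, hlt⟩ := h
  set m := u x₁ + v x₁ with hm
  have hK := isCompact_superlevel hWb (hu.1.add hv.1) (b := b) (b' := (b + m) / 2)
    (by linarith) hb
  obtain ⟨L, hL, hKL, hLW⟩ := exists_compact_between hK hW fun x hx => hx.1
  exact JSub.false_of_interior_max hG hL (hu.1.mono hLW) (hv.1.mono hLW)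
    (fun x hx => hu.2 x (hLW (interior_subset hx))) (fun x hx => hv.2 x (hLW (interior_subset hx)))
    (fun x hx hmx => hKL ⟨hLW hx, hmx⟩) (by linarith : (b + m) / 2 < m)
    (interior_subset (hKL ⟨hx₁, by change _ ≤ u x₁ + v x₁; linarith⟩)) hm.le

end Comparison

section SingularComparison

open scoped RealInnerProductSpace

variable {E : Type*} [NormedAddCommGroup E] [InnerProductSpace ℝ E] {G : Set (E →L[ℝ] E)}
  {W : Set E} {u v : E → ℝ}

lemma JSub.const_mul (hG : ∀ B ∈ G, ∀ t : ℝ, 0 < t → t • B ∈ G) (hu : JSub G W u) {t : ℝ}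
    (ht : 0 < t) : JSub G W (fun y => t * u y) := by
  refine ⟨fun x hx a ha => ?_, fun x hx p B hB => ?_⟩
  · have ha' : u x < a / t := by
      rw [lt_div_iff₀ ht]
      change t * u x < a at ha
      linarith
    filter_upwards [hu.1 x hx (a / t) ha'] with z hz
    rw [lt_div_iff₀ ht] at hz
    linarith
  · have h1 := hB.const_mul (inv_pos.2 ht)
    simp only [← mul_assoc, inv_mul_cancel₀ ht.ne', one_mul] at h1
    have h2 := hG _ (hu.2 x hx _ _ h1) t ht
    rwa [smul_smul, mul_inv_cancel₀ ht.ne', one_smul] at h2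

lemma JSub.add_const (hu : JSub G W u) (c : ℝ) : JSub G W (fun y => u y + c) := by
  refine ⟨fun x hx a ha => ?_, fun x hx p B hB => ?_⟩
  · filter_upwards [hu.1 x hx (a - c) (by linarith)] with z hz
    linarith
  · exact hu.2 x hx p B (hB.mono (Eventually.of_forall fun z => by simp))

lemma JSub.congr (hW : IsOpen W) (hu : JSub G W u) (h : Set.EqOn v u W) : JSub G W v := by
  refine ⟨fun x hx a ha => ?_, fun x hx p B hB => ?_⟩
  · filter_upwards [hu.1 x hx a (by change u x < a; rwa [← h hx]),
      self_mem_nhdsWithin] with z hz hzW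
    change v z < a
    rwa [h hzW]
  · refine hu.2 x hx p B (hB.mono ?_)
    filter_upwards [hW.mem_nhds hx] with z hz
    rw [h hx, h hz]

/-- Comparison of functions which are asymptotic to a function `k` tending to `-∞` along part of
the boundary. -/
lemma JSub.comparison_of_singular [FiniteDimensional ℝ E] (hG : IsSubeq G)
    (hcone : ∀ B ∈ G, ∀ t : ℝ, 0 < t → t • B ∈ G) (hW : IsOpen W)
    (hWb : Bornology.IsBounded W) (hu : JSub G W u) (hv : JSub (dualForms G) W v) {k : E → ℝ}
    {c C M : ℝ} (huk : ∀ z ∈ W, u z ≤ k z + C) (hvk : ∀ z ∈ W, v z ≤ -k z + c)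
    (hb : ∀ x ∈ frontier W, (∀ m : ℝ, ∀ᶠ z in 𝓝[W] x, k z ≤ m) ∨
      ∃ a, |a| ≤ M ∧ ∀ ε > 0, ∀ᶠ z in 𝓝[W] x, u z ≤ a + ε ∧ v z ≤ -a + ε) :
    ∀ x ∈ W, u x + v x ≤ 0 := by
  have key : ∀ δ > (0 : ℝ), δ ≤ 1 → ∀ x ∈ W, (1 + δ) * u x + v x ≤ δ * (|M| + 3) := by
    intro δ hδ hδ1
    refine (hu.const_mul hcone (t := 1 + δ) (by linarith)).comparison hG hW hWb hv
      (b := δ * (|M| + 3)) fun x hx => ?_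
    rcases hb x hx with h | ⟨a, ha, h⟩
    · filter_upwards [h (-(C + c) / δ - C), self_mem_nhdsWithin] with z hz hzW
      have h1 := huk z hzW
      have h2 := hvk z hzW
      have h3 : δ * u z ≤ -(C + c) := by
        have : u z ≤ -(C + c) / δ := by linarith
        rw [le_div_iff₀ hδ] at this
        linarith
      have : 0 ≤ δ * (|M| + 3) := by positivity
      linarith
    · filter_upwards [h δ hδ] with z hz
      have h1 : δ * u z ≤ δ * (a + δ) := by gcongr; exact hz.1
      have h2 : δ * a ≤ δ * |M| := by
        gcongr
        exact (le_abs_self a).trans (ha.trans (le_abs_self M))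
      nlinarith [hz.1, hz.2]
  intro x hx
  by_contra! hpos
  have hlim : Tendsto (fun δ : ℝ => δ * (|M| + 3 - u x)) (𝓝[>] 0) (𝓝 0) := by
    have h1 : Continuous (fun δ : ℝ => δ * (|M| + 3 - u x)) := by fun_prop
    have := h1.tendsto 0
    rw [zero_mul] at this
    exact this.mono_left nhdsWithin_le_nhds
  refine absurd (le_of_tendsto_of_tendsto tendsto_const_nhds hlim ?_) (not_le.2 hpos)
  filter_upwards [Ioc_mem_nhdsGT (zero_lt_one' ℝ)] with δ hδ
  have := key δ hδ.1 hδ.2 x hx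
  linarith

end SingularComparison

section Uniqueness

lemma frontier_diff_subset {E : Type*} [TopologicalSpace E] {Ω Z : Set E} (hW : IsOpen (Ω \ Z))
    (hΩ : IsOpen Ω) : frontier (Ω \ Z) ⊆ frontier Ω ∪ Z := by
  intro x hx
  rw [hW.frontier_eq] at hx
  by_cases hxZ : x ∈ Z
  · exact Or.inr hxZ
  · refine Or.inl ?_
    rw [hΩ.frontier_eq]
    exact ⟨closure_mono (fun y hy => hy.1) hx.1, fun hxΩ => hx.2 ⟨hxΩ, hxZ⟩⟩

variable {F : ConeSubequation n} {Ω Z : Set (EucSp n)} {h : EucSp n → EReal}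

lemma coe_toReal_singular (hhtop : ∀ y ∈ closure Ω, h y ≠ ⊤)
    (hZ : ∀ y ∈ closure Ω, (h y = ⊥ ↔ y ∈ Z)) {y : EucSp n} (hy : y ∈ closure Ω \ Z) :
    ((h y).toReal : EReal) = h y :=
  EReal.coe_toReal (hhtop y hy.1) fun hb => hy.2 ((hZ y hy.1).1 hb)

lemma continuousOn_toReal_singular (hhc : ContinuousOn h (closure Ω))
    (hhtop : ∀ y ∈ closure Ω, h y ≠ ⊤) (hZ : ∀ y ∈ closure Ω, (h y = ⊥ ↔ y ∈ Z)) :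
    ContinuousOn (fun y => (h y).toReal) (closure Ω \ Z) := by
  refine EReal.continuousOn_toReal.comp (hhc.mono fun y hy => hy.1) fun y hy => ?_
  have h1 := hhtop y hy.1
  have h2 : h y ≠ ⊥ := fun hb => hy.2 ((hZ y hy.1).1 hb)
  simp [h1, h2]

lemma eventually_toReal_le (hhc : ContinuousOn h (closure Ω))
    (hhtop : ∀ y ∈ closure Ω, h y ≠ ⊤) (hZ : ∀ y ∈ closure Ω, (h y = ⊥ ↔ y ∈ Z))
    {x : EucSp n} (hx : x ∈ closure Ω) (hxZ : x ∈ Z) (m : ℝ) :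
    ∀ᶠ z in 𝓝[Ω \ Z] x, (h z).toReal ≤ m := by
  have h1 : ∀ᶠ z in 𝓝[closure Ω] x, h z < (m : EReal) := by
    refine (hhc x hx).eventually (gt_mem_nhds ?_)
    rw [(hZ x hx).2 hxZ]
    exact EReal.bot_lt_coe m
  filter_upwards [nhdsWithin_mono x (fun y (hy : y ∈ Ω \ Z) => subset_closure hy.1) h1,
    self_mem_nhdsWithin] with z hz hzW
  rw [← coe_toReal_singular hhtop hZ ⟨subset_closure hzW.1, hzW.2⟩] at hz
  exact (EReal.coe_lt_coe_iff.1 hz).le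

lemma fHarmonicOn_coe_iff {W : Set (EucSp n)} (hW : IsOpen W) {u : EucSp n → ℝ} :
    FHarmonicOn F W (fun y => (u y : EReal)) ↔
      JSub (formSet F.carrier) W u ∧ JSub (dualForms (formSet F.carrier)) W (fun y => -u y) := by
  have hd : IsSubeq (formSet (dualSet F.carrier)) := by
    rw [formSet_dualSet]
    exact F.isSubeq.dual
  have hneg : (fun y => -(u y : EReal)) = fun y => ((-u y : ℝ) : EReal) := by
    funext y
    simp
  rw [FHarmonicOn, fSubharmonicOn_coe_iff F.isSubeq hW, hneg, fSubharmonicOn_coe_iff hd hW,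
    formSet_dualSet]

lemma IsPolarSetSolution.le {φ : EucSp n → ℝ} (hΩ : IsBoundedDomain Ω) (hZΩ : Z ⊆ Ω)
    (hZc : IsCompact Z) (hhc : ContinuousOn h (closure Ω)) (hhtop : ∀ y ∈ closure Ω, h y ≠ ⊤)
    (hZ : ∀ y ∈ closure Ω, (h y = ⊥ ↔ y ∈ Z)) (hφ : ContinuousOn φ (frontier Ω))
    {H₁ H₂ : EucSp n → ℝ} (h₁ : IsPolarSetSolution F Ω Z φ h H₁)
    (h₂ : IsPolarSetSolution F Ω Z φ h H₂) : ∀ y ∈ Ω \ Z, H₁ y ≤ H₂ y := by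
  have hW : IsOpen (Ω \ Z) := hΩ.1.sdiff hZc.isClosed
  obtain ⟨hc1, hh1, hb1, c1, C1, hB1⟩ := h₁
  obtain ⟨hc2, hh2, hb2, c2, C2, hB2⟩ := h₂
  rw [fHarmonicOn_coe_iff hW] at hh1 hh2
  have hfc : IsCompact (frontier Ω) :=
    Metric.isCompact_of_isClosed_isBounded isClosed_frontier
      (hΩ.2.2.closure.subset frontier_subset_closure)
  obtain ⟨M, hM⟩ := hfc.exists_bound_of_continuousOn hφ
  have hreal : ∀ z ∈ Ω \ Z, ((h z).toReal : EReal) = h z := fun z hz =>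
    coe_toReal_singular hhtop hZ ⟨subset_closure hz.1, hz.2⟩
  have hmain := hh1.1.comparison_of_singular F.isSubeq (fun B hB t ht => F.smul_mem hB ht) hW
    (hΩ.2.2.subset fun y hy => hy.1) hh2.2 (k := fun y => (h y).toReal) (c := -c2) (C := C1)
    (M := M) ?_ ?_ ?_
  · intro y hy
    have := hmain y hy
    linarith
  · intro z hz
    have := (hB1 z hz).2
    rw [← hreal z hz] at this
    exact_mod_cast this
  · intro z hz
    have := (hB2 z hz).1
    rw [← hreal z hz] at this
    have h3 : (h z).toReal + c2 ≤ H₂ z := by exact_mod_cast this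
    linarith
  · intro x hx
    rcases frontier_diff_subset hW hΩ.1 hx with hx | hx
    · right
      have hxc : x ∈ closure Ω \ Z :=
        ⟨frontier_subset_closure hx, fun h' => (hΩ.1.frontier_eq ▸ hx).2 (hZΩ h')⟩
      refine ⟨φ x, hM x hx, fun ε hε => ?_⟩
      have hsub : 𝓝[Ω \ Z] x ≤ 𝓝[closure Ω \ Z] x :=
        nhdsWithin_mono x fun y hy => ⟨subset_closure hy.1, hy.2⟩
      have e1 := ((hc1 x hxc).mono_left hsub).eventually (gt_mem_nhds (lt_add_of_pos_right _ hε))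
      have e2 := ((hc2 x hxc).mono_left hsub).eventually (lt_mem_nhds (sub_lt_self _ hε))
      filter_upwards [e1, e2] with z hz1 hz2
      rw [hb1 x hx] at hz1
      rw [hb2 x hx] at hz2
      constructor <;> linarith
    · exact Or.inl fun m => eventually_toReal_le hhc hhtop hZ (subset_closure (hZΩ hx)) hx m

lemma IsPolarSetSolution.eqOn {φ : EucSp n → ℝ} (hΩ : IsBoundedDomain Ω) (hZΩ : Z ⊆ Ω)
    (hZc : IsCompact Z) (hhc : ContinuousOn h (closure Ω)) (hhtop : ∀ y ∈ closure Ω, h y ≠ ⊤)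
    (hZ : ∀ y ∈ closure Ω, (h y = ⊥ ↔ y ∈ Z)) (hφ : ContinuousOn φ (frontier Ω))
    {H₁ H₂ : EucSp n → ℝ} (h₁ : IsPolarSetSolution F Ω Z φ h H₁)
    (h₂ : IsPolarSetSolution F Ω Z φ h H₂) : Set.EqOn H₁ H₂ (closure Ω \ Z) := by
  intro y hy
  by_cases hyΩ : y ∈ Ω
  · exact le_antisymm (h₁.le hΩ hZΩ hZc hhc hhtop hZ hφ h₂ y ⟨hyΩ, hy.2⟩)
      (h₂.le hΩ hZΩ hZc hhc hhtop hZ hφ h₁ y ⟨hyΩ, hy.2⟩)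
  · have hyf : y ∈ frontier Ω := by
      rw [hΩ.1.frontier_eq]
      exact ⟨hy.1, hyΩ⟩
    rw [h₁.2.2.1 y hyf, h₂.2.2.1 y hyf]

end Uniqueness

section Gluing

variable {E : Type*} [NormedAddCommGroup E] {u w : E → ℝ}

/-- The function equal to `max u w` in a ball and to `u` outside of it. -/
def glue (u w : E → ℝ) (x₀ : E) (r : ℝ) (y : E) : ℝ :=
  if dist y x₀ < r then max (u y) (w y) else u y

lemma le_glue (u w : E → ℝ) (x₀ : E) (r : ℝ) (y : E) : u y ≤ glue u w x₀ r y := by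
  unfold glue
  split_ifs
  · exact le_max_left _ _
  · exact le_rfl

lemma glue_le {x₀ y : E} {r b : ℝ} (h : u y ≤ b) (h' : dist y x₀ < r → w y ≤ b) :
    glue u w x₀ r y ≤ b := by
  unfold glue
  split_ifs with h1
  · exact max_le h (h' h1)
  · exact h

end Gluing

section GluedSubsolutions

open scoped RealInnerProductSpace

variable {E : Type*} [NormedAddCommGroup E] [InnerProductSpace ℝ E] {G : Set (E →L[ℝ] E)}
  {W : Set E} {u w : E → ℝ}

lemma JSub.mono {V : Set E} (hu : JSub G W u) (h : V ⊆ W) : JSub G V u :=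
  ⟨hu.1.mono h, fun x hx => hu.2 x (h hx)⟩

lemma JSub.of_local (h : ∀ x ∈ W, ∃ V, IsOpen V ∧ x ∈ V ∧ JSub G (W ∩ V) u) : JSub G W u := by
  refine ⟨fun x hx a ha => ?_, fun x hx p B hB => ?_⟩
  · obtain ⟨V, hV, hxV, hu⟩ := h x hx
    rw [← nhdsWithin_inter_of_mem' (mem_nhdsWithin_of_mem_nhds (hV.mem_nhds hxV))]
    exact hu.1 x ⟨hx, hxV⟩ a ha
  · obtain ⟨V, hV, hxV, hu⟩ := h x hx
    exact hu.2 x ⟨hx, hxV⟩ p B hB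

lemma JSub.max_of_subJet (hG : IsSubeq G) (hu : JSub G W u) (hwc : ContinuousOn w W)
    (hw : ∀ x ∈ W, ∃ q, ∃ B ∈ G, SubJet w x q B) : JSub G W (fun y => max (u y) (w y)) := by
  refine ⟨hu.1.sup hwc.upperSemicontinuousOn, fun x hx p B hB => ?_⟩
  rcases le_total (w x) (u x) with hle | hle
  · refine hu.2 x hx p B (hB.mono (Eventually.of_forall fun z => ?_))
    rw [max_eq_left hle]
    linarith [le_max_left (u z) (w z)]
  · obtain ⟨q, C, hC, hj⟩ := hw x hx
    have h1 : SupJet w x p B := hB.mono (Eventually.of_forall fun z => by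
      rw [max_eq_right hle]
      linarith [le_max_right (u z) (w z)])
    exact hG.mono C hC B (h1.le_of_subJet hj).2

lemma JSub.glue (hG : IsSubeq G) (hW : IsOpen W) (hu : JSub G W u) {x₀ : E} {r s : ℝ}
    (hsr : s < r) (hwc : ContinuousOn w (W ∩ Metric.ball x₀ r))
    (hw : ∀ x ∈ W, dist x x₀ < r → ∃ q, ∃ B ∈ G, SubJet w x q B)
    (hle : ∀ x ∈ W, s < dist x x₀ → dist x x₀ < r → w x ≤ u x) :
    JSub G W (glue u w x₀ r) := by
  refine JSub.of_local fun x hx => ?_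
  rcases lt_or_ge (dist x x₀) r with hxr | hxr
  · refine ⟨Metric.ball x₀ r, Metric.isOpen_ball, hxr, ?_⟩
    refine ((hu.mono Set.inter_subset_left).max_of_subJet hG hwc fun y hy => hw y hy.1 hy.2).congr
      (hW.inter Metric.isOpen_ball) fun y hy => ?_
    have : dist y x₀ < r := hy.2
    simp [_root_.glue, this]
  · refine ⟨(Metric.closedBall x₀ s)ᶜ, Metric.isClosed_closedBall.isOpen_compl, ?_, ?_⟩
    · simp only [Set.mem_compl_iff, Metric.mem_closedBall, not_le]
      linarith
    · refine (hu.mono Set.inter_subset_left).congr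
        (hW.inter Metric.isClosed_closedBall.isOpen_compl) fun y hy => ?_
      have h1 : s < dist y x₀ := by simpa using hy.2
      refine le_antisymm (glue_le le_rfl fun h => hle y hy.1 h1 h) (le_glue _ _ _ _ _)

end GluedSubsolutions

section Envelope

open scoped RealInnerProductSpace

variable {E : Type*} [NormedAddCommGroup E]

/-- The upper semicontinuous envelope of the supremum of a family of functions. -/
def upperEnv (𝓕 : Set (E → ℝ)) (x : E) : ℝ := sInf {m : ℝ | ∀ᶠ y in 𝓝 x, ∀ u ∈ 𝓕, u y ≤ m}

variable {𝓕 : Set (E → ℝ)} {x : E} {m : ℝ}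

lemma bddBelow_upperEnv (hne : 𝓕.Nonempty) :
    BddBelow {m : ℝ | ∀ᶠ y in 𝓝 x, ∀ u ∈ 𝓕, u y ≤ m} := by
  obtain ⟨u, hu⟩ := hne
  exact ⟨u x, fun m hm => (show ∀ᶠ y in 𝓝 x, ∀ u ∈ 𝓕, u y ≤ m from hm).self_of_nhds u hu⟩

lemma upperEnv_le (hne : 𝓕.Nonempty) (h : ∀ᶠ y in 𝓝 x, ∀ u ∈ 𝓕, u y ≤ m) :
    upperEnv 𝓕 x ≤ m := csInf_le (bddBelow_upperEnv hne) h

lemma le_upperEnv (h : ∀ᶠ y in 𝓝 x, ∀ u ∈ 𝓕, u y ≤ m) {u : E → ℝ} (hu : u ∈ 𝓕) :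
    u x ≤ upperEnv 𝓕 x :=
  le_csInf ⟨m, h⟩ fun _ hm' => (show ∀ᶠ y in 𝓝 x, ∀ u ∈ 𝓕, u y ≤ _ from hm').self_of_nhds u hu

lemma eventually_le_of_upperEnv_lt (h : ∀ᶠ y in 𝓝 x, ∀ u ∈ 𝓕, u y ≤ m) {a : ℝ}
    (ha : upperEnv 𝓕 x < a) : ∀ᶠ y in 𝓝 x, ∀ u ∈ 𝓕, u y ≤ a := by
  obtain ⟨m', hm', hlt⟩ := exists_lt_of_csInf_lt ⟨m, h⟩ ha
  filter_upwards [show ∀ᶠ y in 𝓝 x, ∀ u ∈ 𝓕, u y ≤ m' from hm'] with y hy u hu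
  exact (hy u hu).trans hlt.le

lemma frequently_of_lt_upperEnv (hne : 𝓕.Nonempty) {a : ℝ} (ha : a < upperEnv 𝓕 x) :
    ∃ᶠ y in 𝓝 x, ∃ u ∈ 𝓕, a < u y := by
  intro h
  refine absurd (upperEnv_le hne (h.mono fun y hy u hu => ?_)) (not_le.2 ha)
  by_contra! hlt
  exact hy ⟨u, hu, hlt⟩

lemma upperSemicontinuousOn_upperEnv (hne : 𝓕.Nonempty) {W : Set E}
    (hb : ∀ x ∈ W, ∃ m : ℝ, ∀ᶠ y in 𝓝 x, ∀ u ∈ 𝓕, u y ≤ m) :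
    UpperSemicontinuousOn (upperEnv 𝓕) W := by
  intro x hx a ha
  obtain ⟨m, hm⟩ := hb x hx
  obtain ⟨b, hb1, hb2⟩ := exists_between (show upperEnv 𝓕 x < a from ha)
  refine nhdsWithin_le_nhds ?_
  filter_upwards [(eventually_le_of_upperEnv_lt hm hb1).eventually_nhds] with y hy
  exact (upperEnv_le hne hy).trans_lt hb2

/-- The upper envelope of a family of subsolutions is a subsolution. -/
lemma jSub_upperEnv [InnerProductSpace ℝ E] [FiniteDimensional ℝ E] {G : Set (E →L[ℝ] E)}
    (hG : IsSubeq G) (hne : 𝓕.Nonempty) {W : Set E} (hW : IsOpen W)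
    (hb : ∀ x ∈ W, ∃ m : ℝ, ∀ᶠ y in 𝓝 x, ∀ u ∈ 𝓕, u y ≤ m) (h𝓕 : ∀ u ∈ 𝓕, JSub G W u) :
    JSub G W (upperEnv 𝓕) := by
  have := FiniteDimensional.proper_real E
  refine ⟨upperSemicontinuousOn_upperEnv hne hb, fun x₀ hx₀ p B hB => ?_⟩
  refine hG.eventually_mem_of_add fun θ' hθ' => ?_
  obtain ⟨θ, hθ, rfl⟩ : ∃ θ > (0 : ℝ), 4 * θ = θ' := ⟨θ' / 4, by positivity, by ring⟩
  set D := B + (4 * θ) • ContinuousLinearMap.id ℝ E with hD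
  set U := upperEnv 𝓕 with hU
  set q : E → ℝ := fun y => U x₀ + ⟪p, y - x₀⟫ + ⟪D (y - x₀), y - x₀⟫ / 2 with hq
  have hqc : Continuous q := by fun_prop
  have ht : Tendsto (fun y : E => y - x₀) (𝓝 x₀) (𝓝 0) := by
    have : Continuous (fun y : E => y - x₀) := by fun_prop
    simpa using this.tendsto x₀
  have hnear : ∀ᶠ y in 𝓝 x₀, U y - q y ≤ -θ * ‖y - x₀‖ ^ 2 := by
    filter_upwards [ht.eventually (hB θ hθ)] with y hy
    rw [add_sub_cancel] at hy
    simp only [hq, hD, add_apply, smul_apply, ContinuousLinearMap.id_apply, inner_add_left,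
      real_inner_smul_left, real_inner_self_eq_norm_sq]
    linarith
  obtain ⟨r, hr, hball⟩ := Metric.nhds_basis_closedBall.mem_iff.1
    (inter_mem hnear (hW.mem_nhds hx₀))
  have hfreq := frequently_of_lt_upperEnv hne
    (show U x₀ - θ * r ^ 2 / 2 < upperEnv 𝓕 x₀ from sub_lt_self _ (by positivity))
  have hqx : q x₀ = U x₀ := by simp [hq]
  have hqn : ∀ᶠ y in 𝓝 x₀, q y < U x₀ + θ * r ^ 2 / 2 := by
    refine hqc.continuousAt.eventually (gt_mem_nhds ?_)
    rw [hqx]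
    exact lt_add_of_pos_right _ (by positivity)
  obtain ⟨y₁, ⟨u, hu, hy₁⟩, hqy, hyr⟩ :=
    (hfreq.and_eventually (hqn.and (Metric.closedBall_mem_nhds x₀ hr))).exists
  have husc : UpperSemicontinuousOn (fun y => u y + -q y) (Metric.closedBall x₀ r) :=
    ((h𝓕 u hu).1.mono fun y hy => (hball hy).2).add
      (hqc.neg.upperSemicontinuous.upperSemicontinuousOn _)
  obtain ⟨z, hz, hzmax⟩ := husc.exists_isMaxOn ⟨y₁, hyr⟩ (isCompact_closedBall x₀ r)
  have hzW := (hball hz).2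
  have huz : u z ≤ U z := by
    obtain ⟨m, hm⟩ := hb z hzW
    exact le_upperEnv hm hu
  have hzr : dist z x₀ < r := by
    have h1 : u y₁ + -q y₁ ≤ u z + -q z := hzmax hyr
    have h2 : U z - q z ≤ -θ * ‖z - x₀‖ ^ 2 := (hball hz).1
    have h3 : θ * ‖z - x₀‖ ^ 2 < θ * r ^ 2 := by linarith
    rw [dist_eq_norm]
    exact lt_of_pow_lt_pow_left₀ 2 hr.le (lt_of_mul_lt_mul_left h3 hθ.le)
  obtain ⟨q', hq'⟩ := hasJet_quadratic (U x₀) x₀ z p D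
  refine (h𝓕 u hu).2 z hzW q' D (hq'.1.mono ?_)
  filter_upwards [Metric.isOpen_ball.mem_nhds hzr] with y hy
  have : u y + -q y ≤ u z + -q z := hzmax (Metric.ball_subset_closedBall hy)
  simp only [hq] at this
  linarith

end Envelope

section Perron

lemma eventually_le_of_continuousOn {E ι : Type*} [TopologicalSpace E] {W : Set E} {k : E → ℝ}
    (hW : IsOpen W) (hk : ContinuousOn k W)
    {P : ι → Prop} {f : ι → E → ℝ} (h : ∀ i, P i → ∀ z ∈ W, f i z ≤ k z) {x : E} (hx : x ∈ W)
    {m : ℝ} (hm : k x < m) : ∀ᶠ y in 𝓝 x, ∀ i, P i → f i y ≤ m := by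
  filter_upwards [hW.mem_nhds hx, (hk.continuousAt (hW.mem_nhds hx)).eventually (gt_mem_nhds hm)]
    with y hy hy' i hi
  exact (h i hi y hy).trans hy'.le

open scoped RealInnerProductSpace

variable {E : Type*} [NormedAddCommGroup E] [InnerProductSpace ℝ E]

/-- The Perron family: subsolutions between `k + c` and `k + C` with boundary values at most `φ`
on `S`. -/
structure PerronFamily (G : Set (E →L[ℝ] E)) (W S : Set E) (φ k : E → ℝ) (c C : ℝ) (u : E → ℝ) :
    Prop where
  jSub : JSub G W u
  ge : ∀ z ∈ W, k z + c ≤ u z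
  le : ∀ z ∈ W, u z ≤ k z + C
  boundary : ∀ x ∈ S, ∀ ε > 0, ∀ᶠ z in 𝓝[W] x, u z ≤ φ x + ε

variable {G : Set (E →L[ℝ] E)} {W S : Set E} {φ k : E → ℝ} {c C : ℝ}

/-- The bump construction: the largest element of the Perron family is a supersolution. -/
lemma PerronFamily.jSub_dual [FiniteDimensional ℝ E] (hG : IsSubeq G) (hW : IsOpen W)
    (hSW : Disjoint S W) (hk : ContinuousOn k W) (hkd : JSub (dualForms G) W fun y => -k y)
    {U : E → ℝ} (hU : PerronFamily G W S φ k c C U)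
    (hmax : ∀ u, PerronFamily G W S φ k c C u → ∀ z ∈ W, u z ≤ U z) :
    JSub (dualForms G) W (upperEnv {fun y => -U y}) := by
  have := FiniteDimensional.proper_real E
  set N := upperEnv {fun y => -U y} with hN
  have hne : ({fun y => -U y} : Set (E → ℝ)).Nonempty := Set.singleton_nonempty _
  have hb : ∀ x ∈ W, ∃ m : ℝ, ∀ᶠ y in 𝓝 x, ∀ u ∈ ({fun y => -U y} : Set (E → ℝ)), u y ≤ m := by
    intro x hx
    refine ⟨_, eventually_le_of_continuousOn (k := fun y => -k y - c) (P := fun u => u ∈ _)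
      (f := fun u => u) hW (hk.neg.sub continuousOn_const) ?_ hx (lt_add_one _)⟩
    rintro u rfl z hz
    linarith [hU.ge z hz]
  have hUN : ∀ x ∈ W, -U x ≤ N x := fun x hx => by
    obtain ⟨m, hm⟩ := hb x hx
    exact le_upperEnv hm rfl
  refine ⟨upperSemicontinuousOn_upperEnv hne hb, fun x₀ hx₀ p B hB hBint => ?_⟩
  have hkN : ∀ z ∈ W, -k z - C ≤ N z := fun z hz => by linarith [hUN z hz, hU.le z hz]
  rcases (hkN x₀ hx₀).eq_or_lt with heq | hlt
  · refine hkd.2 x₀ hx₀ p B (hB.mono ?_) hBint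
    filter_upwards [hW.mem_nhds hx₀] with z hz
    linarith [hkN z hz]
  obtain ⟨θ, hθ, hθG⟩ : ∃ θ > (0 : ℝ), -B - (4 * θ) • ContinuousLinearMap.id ℝ E ∈ G := by
    have hc : Continuous fun θ : ℝ => -B - (4 * θ) • ContinuousLinearMap.id ℝ E := by fun_prop
    have h1 := hc.tendsto 0
    simp only [mul_zero, zero_smul, sub_zero] at h1
    have h2 : ∀ᶠ θ : ℝ in 𝓝[>] 0, -B - (4 * θ) • ContinuousLinearMap.id ℝ E ∈ G :=
      (h1.mono_left nhdsWithin_le_nhds).eventually (mem_interior_iff_mem_nhds.1 hBint)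
    obtain ⟨θ, h3, h4⟩ := (h2.and self_mem_nhdsWithin).exists
    exact ⟨θ, h4, h3⟩
  set D := -B - (4 * θ) • ContinuousLinearMap.id ℝ E with hD
  set w₀ : E → ℝ := fun y => -N x₀ + ⟪-p, y - x₀⟫ + ⟪D (y - x₀), y - x₀⟫ / 2 with hw₀
  have hwc : Continuous w₀ := by fun_prop
  have hwx : w₀ x₀ = -N x₀ := by simp [hw₀]
  have ht : Tendsto (fun y : E => y - x₀) (𝓝 x₀) (𝓝 0) := by
    have : Continuous (fun y : E => y - x₀) := by fun_prop
    simpa using this.tendsto x₀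
  have hnear : ∀ᶠ y in 𝓝 x₀, N y + w₀ y ≤ -θ * ‖y - x₀‖ ^ 2 := by
    filter_upwards [ht.eventually (hB θ hθ)] with y hy
    rw [add_sub_cancel] at hy
    have hDy : ∀ v, ⟪D v, v⟫ = -⟪B v, v⟫ - 4 * θ * ‖v‖ ^ 2 := fun v => by
      simp only [hD, _root_.sub_apply, neg_apply, smul_apply, ContinuousLinearMap.id_apply,
        inner_sub_left, inner_neg_left, real_inner_smul_left, real_inner_self_eq_norm_sq]
    simp only [hw₀, hDy, inner_neg_left]
    linarith
  set η := (k x₀ + C + N x₀) / 2 with hη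
  have hηpos : 0 < η := by linarith
  have hgap : ∀ᶠ y in 𝓝 x₀, η < k y + C - w₀ y := by
    have hc : ContinuousAt (fun y => k y + C - w₀ y) x₀ :=
      ((hk.continuousAt (hW.mem_nhds hx₀)).add continuousAt_const).sub hwc.continuousAt
    refine hc.eventually (lt_mem_nhds ?_)
    change η < k x₀ + C - w₀ x₀
    rw [hwx]
    linarith
  obtain ⟨r, hr, hball⟩ := Metric.nhds_basis_closedBall.mem_iff.1
    (inter_mem (inter_mem hnear hgap) (hW.mem_nhds hx₀))
  set δ := min η (θ * r ^ 2 / 4) with hδ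
  have hδpos : 0 < δ := lt_min hηpos (by positivity)
  set w : E → ℝ := fun y => w₀ y + δ with hw
  have hbW : ∀ {y}, dist y x₀ < r → y ∈ Metric.closedBall x₀ r :=
    fun h => Metric.ball_subset_closedBall h
  have hmem : PerronFamily G W S φ k c C (glue U w x₀ r) := by
    refine ⟨hU.jSub.glue hG hW (half_lt_self hr) (by fun_prop) ?_ ?_, ?_, ?_, ?_⟩
    · intro x _ _
      obtain ⟨q', hq'⟩ := hasJet_quadratic (-N x₀) x₀ x (-p) D
      exact ⟨q', D, hθG, hq'.2.mono (Eventually.of_forall fun z => by simp [hw, hw₀])⟩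
    · intro x hx h1 h2
      have h3 : N x + w₀ x ≤ -θ * ‖x - x₀‖ ^ 2 := (hball (hbW h2)).1.1
      have h4 : θ * (r / 2) ^ 2 ≤ θ * ‖x - x₀‖ ^ 2 := by
        rw [← dist_eq_norm]
        gcongr
      have h5 : δ ≤ θ * r ^ 2 / 4 := min_le_right _ _
      have := hUN x hx
      simp only [hw]
      linarith
    · exact fun z hz => (hU.ge z hz).trans (le_glue _ _ _ _ _)
    · refine fun z hz => glue_le (hU.le z hz) fun h1 => ?_
      have h2 : η < k z + C - w₀ z := (hball (hbW h1)).1.2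
      have h3 : δ ≤ η := min_le_left _ _
      simp only [hw]
      linarith
    · intro x hx ε hε
      have hxb : x ∈ (Metric.closedBall x₀ r)ᶜ :=
        fun h => Set.disjoint_left.1 hSW hx (hball h).2
      filter_upwards [hU.boundary x hx ε hε, mem_nhdsWithin_of_mem_nhds
        (Metric.isClosed_closedBall.isOpen_compl.mem_nhds hxb)] with z hz hz'
      exact glue_le hz fun h => absurd (hbW h) hz'
  have hw1 : ∀ᶠ y in 𝓝 x₀, -N x₀ + δ / 2 < w y := by
    have hc : Continuous w := by fun_prop
    refine hc.continuousAt.eventually (lt_mem_nhds ?_)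
    simp only [hw, hwx]
    linarith
  obtain ⟨y, ⟨u, rfl, hy⟩, hyw, hyr⟩ := ((frequently_of_lt_upperEnv hne
    (sub_lt_self (N x₀) (half_pos hδpos))).and_eventually
      (hw1.and (Metric.ball_mem_nhds x₀ hr))).exists
  have h1 := hmax _ hmem y (hball (hbW hyr)).2
  have hyr' : dist y x₀ < r := hyr
  have h2 : w y ≤ glue U w x₀ r y := by
    simp [glue, hyr']
  have hy' : N x₀ - δ / 2 < -U y := hy
  linarith

/-- The Perron method, given upper and lower barriers at the points of `S`. -/
theorem exists_perron_solution [FiniteDimensional ℝ E] (hG : IsSubeq G)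
    (hcone : ∀ B ∈ G, ∀ t : ℝ, 0 < t → t • B ∈ G) (hW : IsOpen W) (hWb : Bornology.IsBounded W)
    (hSW : Disjoint S W) (hk : ContinuousOn k W) (hkd : JSub (dualForms G) W fun y => -k y)
    {M : ℝ} (hM : ∀ x ∈ S, |φ x| ≤ M)
    (hfr : ∀ x ∈ frontier W, x ∈ S ∨ ∀ m : ℝ, ∀ᶠ z in 𝓝[W] x, k z ≤ m)
    (hkmem : PerronFamily G W S φ k c C fun y => k y + c)
    (hup : ∀ x ∈ S, ∀ ε > 0, ∀ᶠ z in 𝓝[W] x, ∀ u, PerronFamily G W S φ k c C u → u z ≤ φ x + ε)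
    (hlow : ∀ x ∈ S, ∀ ε > 0, ∃ u, PerronFamily G W S φ k c C u ∧
      ∀ᶠ z in 𝓝[W] x, φ x - ε ≤ u z) :
    ∃ U : E → ℝ, ContinuousOn U W ∧ JSub G W U ∧ JSub (dualForms G) W (fun y => -U y) ∧
      (∀ z ∈ W, k z + c ≤ U z ∧ U z ≤ k z + C) ∧
      ∀ x ∈ S, ∀ ε > 0, ∀ᶠ z in 𝓝[W] x, φ x - ε ≤ U z ∧ U z ≤ φ x + ε := by
  set 𝓕 := {u | PerronFamily G W S φ k c C u} with h𝓕
  have hne : 𝓕.Nonempty := ⟨_, hkmem⟩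
  have hb' : ∀ x ∈ W, ∀ m, k x + C < m → ∀ᶠ y in 𝓝 x, ∀ u ∈ 𝓕, u y ≤ m := fun x hx m hm =>
    eventually_le_of_continuousOn (k := fun y => k y + C) (P := fun u => u ∈ 𝓕)
      (f := fun u => u) hW (hk.add continuousOn_const) (fun u hu => hu.le) hx hm
  have hb : ∀ x ∈ W, ∃ m : ℝ, ∀ᶠ y in 𝓝 x, ∀ u ∈ 𝓕, u y ≤ m :=
    fun x hx => ⟨_, hb' x hx _ (lt_add_one _)⟩
  have hmax : ∀ u, PerronFamily G W S φ k c C u → ∀ z ∈ W, u z ≤ upperEnv 𝓕 z := by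
    intro u hu z hz
    obtain ⟨m, hm⟩ := hb z hz
    exact le_upperEnv hm hu
  have hnhds : ∀ {x : E} {p : E → Prop}, (∀ᶠ z in 𝓝[W] x, p z) →
      ∀ᶠ z in 𝓝[W] x, ∀ᶠ y in 𝓝 z, p y := by
    intro x p hp
    filter_upwards [eventually_eventually_nhdsWithin.2 hp, self_mem_nhdsWithin] with z hz hzW
    rwa [hW.nhdsWithin_eq hzW] at hz
  have hU : PerronFamily G W S φ k c C (upperEnv 𝓕) := by
    refine ⟨jSub_upperEnv hG hne hW hb fun u hu => hu.jSub, hmax _ hkmem, fun z hz => ?_,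
      fun x hx ε hε => ?_⟩
    · refine le_of_forall_gt_imp_ge_of_dense fun m hm => ?_
      exact upperEnv_le hne (hb' z hz m hm)
    · filter_upwards [hnhds (hup x hx ε hε)] with z hz
      exact upperEnv_le hne hz
  set U := upperEnv 𝓕 with hUdef
  have hN := hU.jSub_dual hG hW hSW hk hkd hmax
  set N := upperEnv {fun y => -U y} with hNdef
  have hlowU : ∀ x ∈ S, ∀ ε > 0, ∀ᶠ z in 𝓝[W] x, φ x - ε ≤ U z := by
    intro x hx ε hε
    obtain ⟨u, hu, hu'⟩ := hlow x hx ε hε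
    filter_upwards [hu', self_mem_nhdsWithin] with z hz hzW
    exact hz.trans (hmax u hu z hzW)
  have hsing : ({fun y => -U y} : Set (E → ℝ)).Nonempty := Set.singleton_nonempty _
  have hbN : ∀ x ∈ W, ∀ m, -k x - c < m →
      ∀ᶠ y in 𝓝 x, ∀ u ∈ ({fun y => -U y} : Set (E → ℝ)), u y ≤ m := by
    intro x hx m hm
    refine eventually_le_of_continuousOn (k := fun y => -k y - c) (P := fun u => u ∈ _)
      (f := fun u => u) hW (hk.neg.sub continuousOn_const) ?_ hx hm
    rintro u rfl z hz
    linarith [hU.ge z hz]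
  have hle := hU.jSub.comparison_of_singular hG hcone hW hWb hN (k := k) (c := -c) (C := C)
    (M := M) hU.le ?_ ?_
  · have heq : Set.EqOn (fun y => -U y) N W := by
      intro z hz
      refine le_antisymm (le_upperEnv (hbN z hz _ (lt_add_one _)) rfl) ?_
      have := hle z hz
      change N z ≤ -U z
      linarith
    have hdual : JSub (dualForms G) W fun y => -U y := hN.congr hW heq
    refine ⟨U, ?_, hU.jSub, hdual, fun z hz => ⟨hU.ge z hz, hU.le z hz⟩, fun x hx ε hε =>
      (hlowU x hx ε hε).and (hU.boundary x hx ε hε)⟩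
    rw [continuousOn_iff_lower_upperSemicontinuousOn]
    refine ⟨fun x hx a ha => ?_, hU.jSub.1⟩
    have ha' : -U x < -a := neg_lt_neg ha
    filter_upwards [hdual.1 x hx (-a) ha'] with z hz
    exact neg_lt_neg_iff.1 hz
  · intro z hz
    refine le_of_forall_gt_imp_ge_of_dense fun m hm => ?_
    exact upperEnv_le hsing (hbN z hz m (by linarith))
  · intro x hx
    rcases hfr x hx with hxS | h
    · refine Or.inr ⟨φ x, hM x hxS, fun ε hε => ?_⟩
      filter_upwards [hnhds (hlowU x hxS ε hε), hU.boundary x hxS ε hε] with z hz hz'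
      refine ⟨hz', upperEnv_le hsing ?_⟩
      filter_upwards [hz] with y hy u hu
      rw [hu]
      linarith
    · exact Or.inl h

end Perron

section Barriers

open scoped RealInnerProductSpace

variable {E : Type*} [NormedAddCommGroup E] [InnerProductSpace ℝ E]

lemma HasJet.add_const_mul_sq {f : E → ℝ} {x p : E} {B : E →L[ℝ] E} (h : HasJet f x p B) {K : ℝ}
    (hK : 0 < K) (hx : 0 < 1 + 2 * K * f x) :
    ∃ q, HasJet (fun y => f y + K * f y ^ 2) x q
      ((1 + 2 * K * f x) • B + (2 * K) • tensorSq p) := by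
  have h1 := (h.const_mul hx).add (h.sq_increment.const_mul hK)
  refine ⟨(1 + 2 * K * f x) • p + K • 0, ?_⟩
  have h2 : (2 * K) • tensorSq p = K • (2 : ℝ) • tensorSq p := by
    rw [smul_smul, mul_comm]
  rw [h2]
  refine h1.congr (Eventually.of_forall fun y => ?_)
  ring

variable [FiniteDimensional ℝ E] {G : Set (E →L[ℝ] E)} {ρ : E → ℝ} {x₀ : E}

omit [FiniteDimensional ℝ E] in
lemma continuous_gradient [CompleteSpace E] (hρ : ContDiff ℝ 2 ρ) : Continuous (gradient ρ) :=
  continuous_iff_continuousAt.2 fun _ => (contDiffAt_gradient hρ.contDiffAt).continuousAt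

omit [FiniteDimensional ℝ E] in
lemma continuous_hessOp [CompleteSpace E] (hρ : ContDiff ℝ 2 ρ) : Continuous (hessOp ρ) :=
  continuous_iff_continuousAt.2 fun _ =>
    ((contDiffAt_gradient hρ.contDiffAt).fderiv_right (m := 0) (by simp)).continuousAt

lemma exists_lower_barrier (hρ : ContDiff ℝ 2 ρ) (hx₀ : ρ x₀ = 0) {K : ℝ}
    (hK : 0 < K)
    (hBint : hessOp ρ x₀ + (2 * K) • tensorSq (gradient ρ x₀) ∈ interior G) :
    ∃ q : E → ℝ, Continuous q ∧ q x₀ = 0 ∧ ∃ a > 0, ∀ᶠ y in 𝓝 x₀,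
      (∃ p, ∃ B ∈ G, HasJet q y p B) ∧ (ρ y ≤ 0 → q y ≤ -(a * ‖y - x₀‖ ^ 2)) := by
  have hρc : Continuous ρ := hρ.continuous
  have hgc := continuous_gradient hρ
  have hHc := continuous_hessOp hρ
  obtain ⟨a, ha, haG⟩ : ∃ a > (0 : ℝ), hessOp ρ x₀ + (2 * K) • tensorSq (gradient ρ x₀)
      - (2 * a) • ContinuousLinearMap.id ℝ E ∈ interior G := by
    have hc : Continuous fun a : ℝ => hessOp ρ x₀ + (2 * K) • tensorSq (gradient ρ x₀)
      - (2 * a) • ContinuousLinearMap.id ℝ E := by fun_prop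
    have h1 := hc.tendsto 0
    simp only [mul_zero, zero_smul, sub_zero] at h1
    have h2 : ∀ᶠ a : ℝ in 𝓝[>] 0, hessOp ρ x₀ + (2 * K) • tensorSq (gradient ρ x₀)
      - (2 * a) • ContinuousLinearMap.id ℝ E ∈ interior G :=
      (h1.mono_left nhdsWithin_le_nhds).eventually (isOpen_interior.mem_nhds hBint)
    obtain ⟨a, h3, h4⟩ := (h2.and self_mem_nhdsWithin).exists
    exact ⟨a, h4, h3⟩
  refine ⟨fun y => (ρ y + K * ρ y ^ 2) + -(a * ‖y - x₀‖ ^ 2), by fun_prop, by simp [hx₀], a, ha, ?_⟩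
  have hform : ∀ᶠ y in 𝓝 x₀, (1 + 2 * K * ρ y) • hessOp ρ y + (2 * K) • tensorSq (gradient ρ y)
      + -(a • (2 : ℝ) • ContinuousLinearMap.id ℝ E) ∈ interior G := by
    have hc : Continuous fun y => (1 + 2 * K * ρ y) • hessOp ρ y
        + (2 * K) • tensorSq (gradient ρ y) + -(a • (2 : ℝ) • ContinuousLinearMap.id ℝ E) :=
      (((by fun_prop : Continuous fun y => 1 + 2 * K * ρ y).smul hHc).add
        ((continuous_tensorSq.comp hgc).const_smul (2 * K))).add continuous_const
    refine hc.continuousAt.eventually (isOpen_interior.mem_nhds ?_)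
    simpa only [hx₀, mul_zero, add_zero, one_smul, smul_smul, mul_comm a, ← sub_eq_add_neg]
      using haG
  have hpos : ∀ᶠ y in 𝓝 x₀, 0 < 1 + 2 * K * ρ y := by
    refine (by fun_prop : Continuous fun y => 1 + 2 * K * ρ y).continuousAt.eventually
      (lt_mem_nhds ?_)
    simp [hx₀]
  filter_upwards [hform, hpos] with y hy hy'
  constructor
  · obtain ⟨p, hp⟩ := (hasJet_of_contDiffAt (hρ.contDiffAt (x := y))).add_const_mul_sq hK hy'
    exact ⟨_, _, interior_subset hy, hp.add ((hasJet_norm_sub_sq x₀ y).const_mul ha).neg⟩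
  · intro hle
    have : ρ y * (1 + K * ρ y) ≤ 0 := mul_nonpos_of_nonpos_of_nonneg hle (by nlinarith)
    nlinarith

lemma exists_upper_barrier (hG : IsSubeq G) (hcone : ∀ B ∈ G, ∀ t : ℝ, 0 < t → t • B ∈ G)
    (hρ : ContDiff ℝ 2 ρ) (hx₀ : ρ x₀ = 0) (hnot : -tensorSq (gradient ρ x₀) ∉ G) :
    ∃ q : E → ℝ, Continuous q ∧ q x₀ = 0 ∧ ∀ᶠ y in 𝓝 x₀,
      (∃ p, ∃ B, B ∉ G ∧ HasJet q y p B) ∧ (ρ y ≤ 0 → ‖y - x₀‖ ^ 2 / 2 ≤ q y) := by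
  have hρc : Continuous ρ := hρ.continuous
  have hgc := continuous_gradient hρ
  have hHc := continuous_hessOp hρ
  set f : E → ℝ := fun y => ρ y + -‖y - x₀‖ ^ 2 with hf
  have hfc : Continuous f := by fun_prop
  have hfx : f x₀ = 0 := by simp [hf, hx₀]
  have hjet : ∀ y, HasJet f y (gradient ρ y + -((2 : ℝ) • (y - x₀)))
      (hessOp ρ y + -((2 : ℝ) • ContinuousLinearMap.id ℝ E)) := fun y =>
    (hasJet_of_contDiffAt (hρ.contDiffAt (x := y))).add (hasJet_norm_sub_sq x₀ y).neg
  set H : E → E →L[ℝ] E := fun y => hessOp ρ y + -((2 : ℝ) • ContinuousLinearMap.id ℝ E) with hH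
  obtain ⟨K, hK, hKG⟩ : ∃ K > (0 : ℝ), -(H x₀ + (2 * K) • tensorSq (gradient ρ x₀)) ∉ G := by
    have hc : Continuous fun s : ℝ => -(s • H x₀) - tensorSq (gradient ρ x₀) := by fun_prop
    have h1 := hc.tendsto 0
    simp only [zero_smul, neg_zero, zero_sub] at h1
    have h2 : ∀ᶠ s : ℝ in 𝓝[>] 0, -(s • H x₀) - tensorSq (gradient ρ x₀) ∈ Gᶜ :=
      (h1.mono_left nhdsWithin_le_nhds).eventually (hG.closed.isOpen_compl.mem_nhds hnot)
    obtain ⟨s, h3, h4⟩ := (h2.and self_mem_nhdsWithin).exists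
    have h4 : 0 < s := h4
    refine ⟨(2 * s)⁻¹, by positivity, fun hmem => h3 ?_⟩
    have h5 := hcone _ hmem s h4
    have h6 : s * (2 * (2 * s)⁻¹) = 1 := by field_simp
    rwa [smul_neg, smul_add, smul_smul, h6, one_smul, neg_add, ← sub_eq_add_neg] at h5
  refine ⟨fun y => -(f y + K * f y ^ 2), by fun_prop, by simp [hfx], ?_⟩
  have hform : ∀ᶠ y in 𝓝 x₀, -((1 + 2 * K * f y) • H y
      + (2 * K) • tensorSq (gradient ρ y + -((2 : ℝ) • (y - x₀)))) ∈ Gᶜ := by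
    have hHc' : Continuous H := hHc.add continuous_const
    have hc : Continuous fun y => -((1 + 2 * K * f y) • H y
        + (2 * K) • tensorSq (gradient ρ y + -((2 : ℝ) • (y - x₀)))) :=
      (((by fun_prop : Continuous fun y => 1 + 2 * K * f y).smul hHc').add
        ((continuous_tensorSq.comp (hgc.add (by fun_prop))).const_smul (2 * K))).neg
    refine hc.continuousAt.eventually (hG.closed.isOpen_compl.mem_nhds ?_)
    simpa [hfx] using hKG
  have hpos : ∀ᶠ y in 𝓝 x₀, 0 < 1 + 2 * K * f y := by
    refine (by fun_prop : Continuous fun y => 1 + 2 * K * f y).continuousAt.eventually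
      (lt_mem_nhds ?_)
    simp [hfx]
  filter_upwards [hform, hpos] with y hy hy'
  constructor
  · obtain ⟨p, hp⟩ := (hjet y).add_const_mul_sq hK hy'
    exact ⟨_, _, hy, hp.neg⟩
  · intro hle
    have h1 : f y ≤ -‖y - x₀‖ ^ 2 := by simp only [hf]; linarith
    have h2 : f y ≤ 0 := h1.trans (by simp)
    have h3 : f y * (1 / 2 + K * f y) ≤ 0 := mul_nonpos_of_nonpos_of_nonneg h2 (by linarith)
    nlinarith

end Barriers

section Existence

open scoped RealInnerProductSpace

variable {E : Type*} [NormedAddCommGroup E] [InnerProductSpace ℝ E] {G : Set (E →L[ℝ] E)}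

/-- A subsolution lies below any function whose second order behaviour is nowhere in `G`, if it
does so near the boundary. -/
lemma JSub.le_of_supJet_notMem [FiniteDimensional ℝ E] {A : Set E} (hA : IsOpen A)
    (hAb : Bornology.IsBounded A) {u w : E → ℝ} (hu : JSub G A u) (hwc : Continuous w)
    (hw : ∀ x ∈ A, ∃ p, ∃ B, B ∉ G ∧ SupJet w x p B)
    (hb : ∀ η > 0, ∀ x ∈ frontier A, ∀ᶠ z in 𝓝[A] x, u z ≤ w z + η) : ∀ x ∈ A, u x ≤ w x := by
  by_contra! hcon
  obtain ⟨x₁, hx₁, hlt⟩ := hcon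
  have husc : UpperSemicontinuousOn (fun y => u y + -w y) A :=
    hu.1.add (hwc.neg.upperSemicontinuous.upperSemicontinuousOn _)
  set m := u x₁ + -w x₁ with hm
  have hmpos : 0 < m := by linarith
  have hK := isCompact_superlevel hAb husc (b := m / 2) (b' := m) (by linarith) fun x hx => by
    filter_upwards [hb (m / 2) (by positivity) x hx] with z hz
    linarith
  have husc' : UpperSemicontinuousOn (fun y => u y + -w y) {x ∈ A | m ≤ u x + -w x} :=
    husc.mono fun x hx => hx.1
  have hne : {x ∈ A | m ≤ u x + -w x}.Nonempty := ⟨x₁, hx₁, le_rfl⟩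
  obtain ⟨z, hz, hzmax⟩ := husc'.exists_isMaxOn hne hK
  obtain ⟨p, B, hB, hj⟩ := hw z hz.1
  refine hB (hu.2 z hz.1 p B (hj.mono ?_))
  filter_upwards [hA.mem_nhds hz.1] with y hy
  have hzm : m ≤ u z + -w z := hz.2
  by_cases hym : m ≤ u y + -w y
  · have : u y + -w y ≤ u z + -w z := hzmax ⟨hy, hym⟩
    linarith
  · linarith

variable {Ω Z : Set E} {φ k : E → ℝ}

lemma PerronFamily.eventually_le [FiniteDimensional ℝ E]
    (hcone : ∀ B ∈ G, ∀ t : ℝ, 0 < t → t • B ∈ G)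
    (hΩ : IsOpen Ω) (hΩb : Bornology.IsBounded Ω) (hZΩ : Z ⊆ Ω) (hZc : IsClosed Z)
    (hφ : ContinuousOn φ (frontier Ω)) (hk : ContinuousOn k (closure Ω \ Z)) {c C : ℝ} {x₀ : E}
    (hx₀ : x₀ ∈ frontier Ω) {q : E → ℝ} (hqc : Continuous q) (hq0 : q x₀ = 0)
    (hq : ∀ᶠ y in 𝓝 x₀, (∃ p, ∃ B, B ∉ G ∧ HasJet q y p B) ∧
      (y ∈ closure Ω → ‖y - x₀‖ ^ 2 / 2 ≤ q y))
    {ε : ℝ} (hε : 0 < ε) :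
    ∀ᶠ z in 𝓝[Ω \ Z] x₀, ∀ u, PerronFamily G (Ω \ Z) (frontier Ω) φ k c C u → u z ≤ φ x₀ + ε := by
  have hW : IsOpen (Ω \ Z) := hΩ.sdiff hZc
  have hx₀Z : x₀ ∉ Z := fun h => (hΩ.frontier_eq ▸ hx₀).2 (hZΩ h)
  have hx₀c : x₀ ∈ closure Ω \ Z := ⟨frontier_subset_closure hx₀, hx₀Z⟩
  have hkn : ∀ᶠ y in 𝓝 x₀, y ∈ closure Ω \ Z → k y < k x₀ + 1 :=
    eventually_nhdsWithin_iff.1 ((hk x₀ hx₀c).eventually (gt_mem_nhds (lt_add_one _)))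
  have hφn : ∀ᶠ y in 𝓝 x₀, y ∈ frontier Ω → φ y < φ x₀ + ε / 2 :=
    eventually_nhdsWithin_iff.1 ((hφ x₀ hx₀).eventually
      (gt_mem_nhds (lt_add_of_pos_right _ (half_pos hε))))
  obtain ⟨r, hr, hball⟩ := Metric.nhds_basis_closedBall.mem_iff.1
    (inter_mem (inter_mem (inter_mem hq hkn) hφn) (hZc.isOpen_compl.mem_nhds hx₀Z))
  obtain ⟨Λ, hΛ, hΛ'⟩ : ∃ Λ > 0, k x₀ + 1 + C ≤ φ x₀ + ε / 2 + Λ * (r ^ 2 / 8) := by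
    refine ⟨(|k x₀ + 1 + C - (φ x₀ + ε / 2)| + 1) / (r ^ 2 / 8), by positivity, ?_⟩
    rw [div_mul_cancel₀ _ (by positivity)]
    linarith [le_abs_self (k x₀ + 1 + C - (φ x₀ + ε / 2))]
  set w : E → ℝ := fun y => φ x₀ + ε / 2 + Λ * q y with hw
  have hwc : Continuous w := by fun_prop
  have hwn : ∀ᶠ z in 𝓝 x₀, w z < φ x₀ + ε := by
    refine hwc.continuousAt.eventually (gt_mem_nhds ?_)
    simp only [hw, hq0]
    linarith
  filter_upwards [mem_nhdsWithin_of_mem_nhds hwn, self_mem_nhdsWithin,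
    mem_nhdsWithin_of_mem_nhds (Metric.ball_mem_nhds x₀ hr)] with z hz hzW hzr u hu
  refine le_trans ?_ hz.le
  have hqpos : ∀ y ∈ Metric.closedBall x₀ r, y ∈ closure Ω → ‖y - x₀‖ ^ 2 / 2 ≤ q y :=
    fun y hy hyc => (hball hy).1.1.1.2 hyc
  refine (hu.jSub.mono (Set.inter_subset_left (t := Metric.ball x₀ r))).le_of_supJet_notMem
    (hW.inter Metric.isOpen_ball) (hΩb.subset fun y hy => hy.1.1) hwc ?_ ?_ z ⟨hzW, hzr⟩
  · intro x hx
    obtain ⟨p, B, hB, hj⟩ := (hball (Metric.ball_subset_closedBall hx.2)).1.1.1.1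
    refine ⟨Λ • p, Λ • B, fun hmem => hB ?_, (hj.const_mul hΛ).1.mono
      (Eventually.of_forall fun y => by simp [hw])⟩
    have := hcone _ hmem Λ⁻¹ (inv_pos.2 hΛ)
    rwa [smul_smul, inv_mul_cancel₀ hΛ.ne', one_smul] at this
  · intro η hη x hx
    have hxc : x ∈ closure (Ω \ Z ∩ Metric.ball x₀ r) := frontier_subset_closure hx
    have hxΩ : x ∈ closure Ω := closure_mono (fun y hy => hy.1.1) hxc
    have hxr : x ∈ Metric.closedBall x₀ r :=
      Metric.closure_ball_subset_closedBall (closure_mono Set.inter_subset_right hxc)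
    rcases lt_or_ge (dist x x₀) r with hlt | hge
    · have hxZ : x ∉ Z := (hball hxr).2
      have hxf : x ∈ frontier Ω := by
        rw [hΩ.frontier_eq]
        refine ⟨hxΩ, fun h => ?_⟩
        rw [(hW.inter Metric.isOpen_ball).frontier_eq] at hx
        exact hx.2 ⟨⟨h, hxZ⟩, hlt⟩
      have hφx : φ x < φ x₀ + ε / 2 := (hball hxr).1.2 hxf
      filter_upwards [nhdsWithin_mono x Set.inter_subset_left (hu.boundary x hxf η hη),
        self_mem_nhdsWithin] with y hy hyA
      have h1 := hqpos y (Metric.ball_subset_closedBall hyA.2) (subset_closure hyA.1.1)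
      have h2 : 0 ≤ Λ * q y := mul_nonneg hΛ.le (le_trans (by positivity) h1)
      simp only [hw]
      linarith
    · have hn : ∀ᶠ y in 𝓝 x, r / 2 < dist y x₀ :=
        (continuous_id.dist continuous_const).continuousAt.eventually
          (lt_mem_nhds (lt_of_lt_of_le (half_lt_self hr) hge))
      filter_upwards [mem_nhdsWithin_of_mem_nhds hn, self_mem_nhdsWithin] with y hy hyA
      have hyr := Metric.ball_subset_closedBall hyA.2
      have h1 := hqpos y hyr (subset_closure hyA.1.1)
      have h2 : k y < k x₀ + 1 := (hball hyr).1.1.2 ⟨subset_closure hyA.1.1, hyA.1.2⟩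
      have h3 := hu.le y hyA.1
      have h4 : r ^ 2 / 8 ≤ q y := by
        rw [dist_eq_norm] at hy
        nlinarith
      have h5 : Λ * (r ^ 2 / 8) ≤ Λ * q y := by gcongr
      simp only [hw]
      linarith

lemma exists_perronFamily_ge (hG : IsSubeq G) [FiniteDimensional ℝ E]
    (hcone : ∀ B ∈ G, ∀ t : ℝ, 0 < t → t • B ∈ G)
    (hΩ : IsOpen Ω) (hZΩ : Z ⊆ Ω) (hZc : IsClosed Z)
    (hφ : ContinuousOn φ (frontier Ω)) (hk : ContinuousOn k (closure Ω \ Z)) {c C M M' : ℝ}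
    (hM : ∀ x ∈ frontier Ω, |φ x| ≤ M) (hM' : ∀ x ∈ frontier Ω, |k x| ≤ M') (hC : M + M' + 1 ≤ C)
    (hkmem : PerronFamily G (Ω \ Z) (frontier Ω) φ k c C fun y => k y + c) {x₀ : E}
    (hx₀ : x₀ ∈ frontier Ω) {q : E → ℝ} (hqc : Continuous q) (hq0 : q x₀ = 0) {a : ℝ} (ha : 0 < a)
    (hq : ∀ᶠ y in 𝓝 x₀, (∃ p, ∃ B ∈ G, HasJet q y p B) ∧
      (y ∈ closure Ω → q y ≤ -(a * ‖y - x₀‖ ^ 2))) {ε : ℝ} (hε : 0 < ε) :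
    ∃ u, PerronFamily G (Ω \ Z) (frontier Ω) φ k c C u ∧
      ∀ᶠ z in 𝓝[Ω \ Z] x₀, φ x₀ - ε ≤ u z := by
  have hW : IsOpen (Ω \ Z) := hΩ.sdiff hZc
  have hx₀Z : x₀ ∉ Z := fun h => (hΩ.frontier_eq ▸ hx₀).2 (hZΩ h)
  have hx₀c : x₀ ∈ closure Ω \ Z := ⟨frontier_subset_closure hx₀, hx₀Z⟩
  have hkn : ∀ᶠ y in 𝓝 x₀, y ∈ closure Ω \ Z → k x₀ - 1 < k y :=
    eventually_nhdsWithin_iff.1 ((hk x₀ hx₀c).eventually (lt_mem_nhds (sub_one_lt _)))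
  have hφn : ∀ᶠ y in 𝓝 x₀, y ∈ frontier Ω → φ x₀ - ε / 2 < φ y :=
    eventually_nhdsWithin_iff.1 ((hφ x₀ hx₀).eventually
      (lt_mem_nhds (sub_lt_self _ (half_pos hε))))
  obtain ⟨r, hr, hball⟩ := Metric.nhds_basis_closedBall.mem_iff.1
    (inter_mem (inter_mem hq hkn) hφn)
  obtain ⟨Λ, hΛ, hΛ'⟩ : ∃ Λ > 0, M + M' + 1 - c ≤ Λ * (a * r ^ 2 / 4) := by
    refine ⟨(|M + M' + 1 - c| + 1) / (a * r ^ 2 / 4), by positivity, ?_⟩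
    rw [div_mul_cancel₀ _ (by positivity)]
    linarith [le_abs_self (M + M' + 1 - c)]
  set w : E → ℝ := fun y => φ x₀ - ε / 2 + Λ * q y with hw
  have hwc : Continuous w := by fun_prop
  have hwn : ∀ᶠ z in 𝓝 x₀, φ x₀ - ε < w z := by
    refine hwc.continuousAt.eventually (lt_mem_nhds ?_)
    simp only [hw, hq0]
    linarith
  have hφ0 := abs_le.1 (hM x₀ hx₀)
  have hk0 := abs_le.1 (hM' x₀ hx₀)
  have hwle : ∀ y ∈ Ω \ Z, dist y x₀ < r →
      w y ≤ φ x₀ - ε / 2 ∧ k x₀ - 1 < k y ∧ w y ≤ φ x₀ - ε / 2 - Λ * (a * dist y x₀ ^ 2) := by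
    intro y hy hyr
    have hyr' := Metric.ball_subset_closedBall hyr
    have h1 : q y ≤ -(a * ‖y - x₀‖ ^ 2) := (hball hyr').1.1.2 (subset_closure hy.1)
    rw [← dist_eq_norm] at h1
    have h2 : Λ * q y ≤ Λ * -(a * dist y x₀ ^ 2) := by gcongr
    have h3 : 0 ≤ Λ * (a * dist y x₀ ^ 2) := by positivity
    refine ⟨?_, (hball hyr').1.2 ⟨subset_closure hy.1, hy.2⟩, ?_⟩ <;>
    · simp only [hw]
      linarith
  refine ⟨glue (fun y => k y + c) w x₀ r, ⟨?_, ?_, ?_, ?_⟩, ?_⟩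
  · refine hkmem.jSub.glue hG hW (half_lt_self hr) hwc.continuousOn ?_ ?_
    · intro x _ hxr
      obtain ⟨p, B, hB, hj⟩ := (hball (Metric.ball_subset_closedBall hxr)).1.1.1
      exact ⟨Λ • p, Λ • B, hcone _ hB Λ hΛ, (hj.const_mul hΛ).2.mono
        (Eventually.of_forall fun y => by simp [hw])⟩
    · intro x hx h1 h2
      obtain ⟨-, h3, h4⟩ := hwle x hx h2
      have h5 : Λ * (a * r ^ 2 / 4) ≤ Λ * (a * dist x x₀ ^ 2) := by
        have : (r / 2) ^ 2 ≤ dist x x₀ ^ 2 := by gcongr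
        have : a * r ^ 2 / 4 ≤ a * dist x x₀ ^ 2 := by nlinarith
        gcongr
      linarith
  · exact fun z _ => le_glue (fun y => k y + c) w x₀ r z
  · refine fun z hz => glue_le (hkmem.le z hz) fun hzr => ?_
    obtain ⟨h1, h2, -⟩ := hwle z hz hzr
    linarith
  · intro x hx η hη
    rcases le_or_gt (dist x x₀) r with hle | hlt
    · have h1 : φ x₀ - ε / 2 < φ x := (hball hle).2 hx
      filter_upwards [hkmem.boundary x hx η hη, self_mem_nhdsWithin] with z hz hzW
      refine glue_le hz fun hzr => ?_
      have := (hwle z hzW hzr).1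
      linarith
    · have hn : ∀ᶠ y in 𝓝 x, r < dist y x₀ :=
        (continuous_id.dist continuous_const).continuousAt.eventually (lt_mem_nhds hlt)
      filter_upwards [hkmem.boundary x hx η hη, mem_nhdsWithin_of_mem_nhds hn] with z hz hzr
      exact glue_le hz fun h => absurd h hzr.not_gt
  · filter_upwards [mem_nhdsWithin_of_mem_nhds hwn,
      mem_nhdsWithin_of_mem_nhds (Metric.ball_mem_nhds x₀ hr)] with z hz hzr
    have hzr' : dist z x₀ < r := hzr
    simp only [glue, hzr', if_true]
    exact hz.le.trans (le_max_right _ _)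

/-- Solvability of the Dirichlet problem with prescribed singularity, given barriers. -/
theorem exists_dirichlet_solution [FiniteDimensional ℝ E] (hG : IsSubeq G)
    (hcone : ∀ B ∈ G, ∀ t : ℝ, 0 < t → t • B ∈ G) (hΩ : IsOpen Ω) (hΩb : Bornology.IsBounded Ω)
    (hZΩ : Z ⊆ Ω) (hZc : IsClosed Z) (hφ : ContinuousOn φ (frontier Ω))
    (hk : ContinuousOn k (closure Ω \ Z)) (hkZ : ∀ x ∈ Z, ∀ m : ℝ, ∀ᶠ z in 𝓝[Ω \ Z] x, k z ≤ m)
    (hks : JSub G (Ω \ Z) k) (hkd : JSub (dualForms G) (Ω \ Z) fun y => -k y)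
    (hlow : ∀ x₀ ∈ frontier Ω, ∃ q : E → ℝ, Continuous q ∧ q x₀ = 0 ∧ ∃ a > 0, ∀ᶠ y in 𝓝 x₀,
      (∃ p, ∃ B ∈ G, HasJet q y p B) ∧ (y ∈ closure Ω → q y ≤ -(a * ‖y - x₀‖ ^ 2)))
    (hup : ∀ x₀ ∈ frontier Ω, ∃ q : E → ℝ, Continuous q ∧ q x₀ = 0 ∧ ∀ᶠ y in 𝓝 x₀,
      (∃ p, ∃ B, B ∉ G ∧ HasJet q y p B) ∧ (y ∈ closure Ω → ‖y - x₀‖ ^ 2 / 2 ≤ q y)) :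
    ∃ H : E → ℝ, ContinuousOn H (closure Ω \ Z) ∧ JSub G (Ω \ Z) H ∧
      JSub (dualForms G) (Ω \ Z) (fun y => -H y) ∧ (∀ y ∈ frontier Ω, H y = φ y) ∧
      ∃ c C : ℝ, ∀ z ∈ Ω \ Z, k z + c ≤ H z ∧ H z ≤ k z + C := by
  have := FiniteDimensional.proper_real E
  have hW : IsOpen (Ω \ Z) := hΩ.sdiff hZc
  have hfc : IsCompact (frontier Ω) :=
    Metric.isCompact_of_isClosed_isBounded isClosed_frontier
      (hΩb.closure.subset frontier_subset_closure)
  have hfΩ : ∀ x ∈ frontier Ω, x ∉ Ω := fun x hx => (hΩ.frontier_eq ▸ hx).2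
  have hfcl : ∀ x ∈ frontier Ω, x ∈ closure Ω \ Z := fun x hx =>
    ⟨frontier_subset_closure hx, fun h => hfΩ x hx (hZΩ h)⟩
  have hWcl : Ω \ Z ⊆ closure Ω \ Z := fun y hy => ⟨subset_closure hy.1, hy.2⟩
  obtain ⟨M, hM⟩ := hfc.exists_bound_of_continuousOn hφ
  obtain ⟨M', hM'⟩ := hfc.exists_bound_of_continuousOn (hk.mono hfcl)
  set C := |M| + |M'| + 1 with hC
  set c := -(|M| + |M'|) with hc
  have hM1 : ∀ x ∈ frontier Ω, |φ x| ≤ |M| := fun x hx => (hM x hx).trans (le_abs_self M)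
  have hM1' : ∀ x ∈ frontier Ω, |k x| ≤ |M'| := fun x hx => (hM' x hx).trans (le_abs_self M')
  have hkmem : PerronFamily G (Ω \ Z) (frontier Ω) φ k c C fun y => k y + c := by
    refine ⟨hks.add_const c, fun z _ => le_rfl, fun z _ => ?_, fun x hx ε hε => ?_⟩
    · have h1 := abs_nonneg M
      have h2 := abs_nonneg M'
      linarith
    · have h1 := ((hk x (hfcl x hx)).mono_left (nhdsWithin_mono x hWcl)).eventually
        (gt_mem_nhds (lt_add_of_pos_right (k x) hε))
      filter_upwards [h1] with z hz
      linarith [(abs_le.1 (hM1 x hx)).1, (abs_le.1 (hM1' x hx)).2]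
  obtain ⟨U, hUc, hUs, hUd, hUb, hUS⟩ := exists_perron_solution hG hcone hW
    (hΩb.subset fun y hy => hy.1) (Set.disjoint_left.2 fun x hx h => hfΩ x hx h.1)
    (hk.mono hWcl) hkd hM1
    (fun x hx => (frontier_diff_subset hW hΩ hx).imp_right (hkZ x)) hkmem
    (fun x hx ε hε => by
      obtain ⟨q, hqc, hq0, hq⟩ := hup x hx
      exact PerronFamily.eventually_le hcone hΩ hΩb hZΩ hZc hφ hk hx hqc hq0 hq hε)
    (fun x hx ε hε => by
      obtain ⟨q, hqc, hq0, a, ha, hq⟩ := hlow x hx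
      exact exists_perronFamily_ge hG hcone hΩ hZΩ hZc hφ hk hM1 hM1' le_rfl hkmem hx hqc hq0
        ha hq hε)
  set H : E → ℝ := fun y => if y ∈ Ω then U y else φ y with hH
  have hHU : Set.EqOn H U (Ω \ Z) := fun y hy => if_pos hy.1
  have hHφ : ∀ y ∈ frontier Ω, H y = φ y := fun y hy => if_neg (hfΩ y hy)
  refine ⟨H, fun x hx => ?_, hUs.congr hW hHU, hUd.congr hW fun y hy => by simp [hHU hy], hHφ,
    c, C, fun z hz => by rw [hHU hz]; exact hUb z hz⟩
  by_cases hxΩ : x ∈ Ω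
  · have hxW : Ω \ Z ∈ 𝓝 x := hW.mem_nhds ⟨hxΩ, hx.2⟩
    exact ((hUc.continuousAt hxW).congr
      (Filter.eventuallyEq_of_mem hxW fun y hy => (hHU hy).symm)).continuousWithinAt
  · have hxf : x ∈ frontier Ω := by
      rw [hΩ.frontier_eq]
      exact ⟨hx.1, hxΩ⟩
    refine Metric.tendsto_nhds.2 fun ε hε => ?_
    have h1 : ∀ᶠ y in 𝓝 x, y ∈ frontier Ω → dist (φ y) (φ x) < ε :=
      eventually_nhdsWithin_iff.1 (Metric.tendsto_nhds.1 (hφ x hxf) ε hε)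
    have h2 : ∀ᶠ y in 𝓝 x, y ∈ Ω \ Z → φ x - ε / 2 ≤ U y ∧ U y ≤ φ x + ε / 2 :=
      eventually_nhdsWithin_iff.1 (hUS x hxf (ε / 2) (half_pos hε))
    filter_upwards [mem_nhdsWithin_of_mem_nhds h1, mem_nhdsWithin_of_mem_nhds h2,
      self_mem_nhdsWithin] with y hy1 hy2 hyc
    rw [hHφ x hxf]
    by_cases hyΩ : y ∈ Ω
    · have h3 := hy2 ⟨hyΩ, hyc.2⟩
      rw [hHU ⟨hyΩ, hyc.2⟩, Real.dist_eq, abs_lt]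
      constructor <;> linarith [h3.1, h3.2]
    · have hyf : y ∈ frontier Ω := by
        rw [hΩ.frontier_eq]
        exact ⟨hyc.1, hyΩ⟩
      rw [hHφ y hyf]
      exact hy1 hyf

end Existence

section StrictConvexity

open scoped RealInnerProductSpace Matrix

/-- If the form `m⁻¹ • QHQ + t • P_e` is interior to a conical subequation, `Q` being the
projection along the unit vector `e`, then so is `H + s • P_e` for large `s`. -/
lemma IsSubeq.exists_add_smul_mem_interior {E : Type*} [NormedAddCommGroup E]
    [InnerProductSpace ℝ E] {G : Set (E →L[ℝ] E)} (hG : IsSubeq G)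
    (hcone : ∀ B ∈ G, ∀ t : ℝ, 0 < t → t • B ∈ G) {A B : E →L[ℝ] E} {e : E} {m t : ℝ}
    (hm : 0 < m) (hA : A ∈ interior G)
    (hAB : ∀ v, ⟪A v, v⟫ = m⁻¹ * ⟪B (v - ⟪e, v⟫ • e), v - ⟪e, v⟫ • e⟫ + t * ⟪e, v⟫ ^ 2)
    (he : ‖e‖ = 1) : ∃ s₀ : ℝ, ∀ s ≥ s₀, B + s • tensorSq e ∈ interior G := by
  obtain ⟨θ, hθ, hθA⟩ : ∃ θ > (0 : ℝ), A - θ • ContinuousLinearMap.id ℝ E ∈ G := by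
    have h1 : Continuous fun θ : ℝ => A - θ • ContinuousLinearMap.id ℝ E := by fun_prop
    have h2 := h1.tendsto 0
    rw [zero_smul, sub_zero] at h2
    have h3 := (h2.eventually (mem_interior_iff_mem_nhds.1 hA)).filter_mono
      (nhdsWithin_le_nhds (s := Set.Ioi 0))
    obtain ⟨θ, h4, h5⟩ := (h3.and self_mem_nhdsWithin).exists
    exact ⟨θ, h5, h4⟩
  have hmθ : 0 < m * θ := by positivity
  have hBint := hG.add_mem_interior (hcone _ hθA m hm) (half_pos hmθ)
  refine ⟨m * t + ‖B‖ + 2 * ‖B‖ ^ 2 / (m * θ), fun s hs => hG.interior_mono hBint fun v => ?_⟩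
  set a := ⟪e, v⟫ with ha
  set Q := v - a • e with hQ
  have hv : v = Q + a • e := by rw [hQ]; abel
  have hsplit : ⟪B v, v⟫ = ⟪B Q, Q⟫ + a * ⟪B v, e⟫ + a * ⟪B e, v⟫ - a ^ 2 * ⟪B e, e⟫ := by
    rw [hQ]
    simp only [map_sub, map_smul, inner_sub_left, inner_sub_right, real_inner_smul_left,
      real_inner_smul_right]
    ring
  have hbound : ∀ x y : E, |⟪B x, y⟫| ≤ ‖B‖ * ‖x‖ * ‖y‖ := fun x y =>
    (abs_real_inner_le_norm _ _).trans (by gcongr; exact B.le_opNorm x)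
  have h1 := hbound v e
  have h2 := hbound e v
  have h3 := hbound e e
  rw [he] at h1 h2 h3
  have h4 : -(|a| * (‖B‖ * ‖v‖)) ≤ a * ⟪B v, e⟫ := by
    refine neg_le_of_abs_le ?_
    rw [abs_mul]
    gcongr
    linarith
  have h5 : -(|a| * (‖B‖ * ‖v‖)) ≤ a * ⟪B e, v⟫ := by
    refine neg_le_of_abs_le ?_
    rw [abs_mul]
    gcongr
    linarith
  have h6 : a ^ 2 * ⟪B e, e⟫ ≤ a ^ 2 * ‖B‖ := by
    gcongr
    linarith [le_abs_self ⟪B e, e⟫]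
  have h7 : 2 * (|a| * (‖B‖ * ‖v‖)) ≤ m * θ / 2 * ‖v‖ ^ 2 + 2 * ‖B‖ ^ 2 / (m * θ) * a ^ 2 := by
    have h8 : 2 * ‖B‖ ^ 2 / (m * θ) * a ^ 2 = (2 * (‖B‖ * |a|) ^ 2) / (m * θ) := by
      rw [mul_pow, sq_abs]
      ring
    rw [h8, ← sub_nonneg]
    have h9 : m * θ / 2 * ‖v‖ ^ 2 + (2 * (‖B‖ * |a|) ^ 2) / (m * θ) - 2 * (|a| * (‖B‖ * ‖v‖))
        = (m * θ * ‖v‖ - 2 * (‖B‖ * |a|)) ^ 2 / (2 * (m * θ)) := by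
      field_simp
      ring
    rw [h9]
    positivity
  have h10 := mul_le_mul_of_nonneg_right hs (sq_nonneg a)
  have h11 : m * ⟪A v, v⟫ = ⟪B Q, Q⟫ + m * t * a ^ 2 := by
    rw [hAB v, ← ha, ← hQ]
    field_simp
  simp only [_root_.sub_apply, add_apply, smul_apply, ContinuousLinearMap.id_apply,
    inner_add_left, inner_sub_left, real_inner_smul_left, real_inner_self_eq_norm_sq,
    inner_tensorSq]
  rw [hsplit]
  linarith

lemma inner_eq_dotProduct_toSym (B : EucSp n →L[ℝ] EucSp n) (v : EucSp n) :
    ⟪B v, v⟫ = v.ofLp ⬝ᵥ ((toSym B).1 *ᵥ v.ofLp) := by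
  rw [form_apply_eq_sum]
  simp only [dotProduct, Matrix.mulVec, Finset.mul_sum]
  refine Finset.sum_congr rfl fun i _ => Finset.sum_congr rfl fun j _ => by ring

lemma projMat_mulVec (e v : EucSp n) : projMat e *ᵥ v.ofLp = (⟪e, v⟫ • e).ofLp := by
  ext i
  simp only [projMat, Matrix.mulVec, dotProduct, Matrix.of_apply, PiLp.inner_apply,
    PiLp.smul_apply, smul_eq_mul, Finset.sum_mul]
  refine Finset.sum_congr rfl fun j _ => ?_
  simp
  ring

lemma toSym_tensorSq (e : EucSp n) : toSym (tensorSq e) = symProj e := by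
  apply Subtype.ext
  ext i j
  rw [toSym_apply]
  simp [tensorSq, symProj, projMat, EuclideanSpace.inner_single_right]
  ring

/-- Strict convexity in terms of the defining function. -/
lemma exists_hessOp_add_mem_interior (F : ConeSubequation n) {ρ : EucSp n → ℝ}
    (hρ : ContDiff ℝ 2 ρ) {x : EucSp n} (hgrad : gradient ρ x ≠ 0) {t : ℝ}
    (ht : secondFF ρ x + t • projMat (innerNormal ρ x) ∈ Subtype.val '' interior F.carrier) :
    ∃ K : ℝ, 0 < K ∧
      hessOp ρ x + (2 * K) • tensorSq (gradient ρ x) ∈ interior (formSet F.carrier) := by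
  obtain ⟨A, hA, hAeq⟩ := ht
  set m := ‖gradient ρ x‖ with hm
  have hmpos : 0 < m := norm_pos_iff.2 hgrad
  set e := innerNormal ρ x with he
  have he1 : ‖e‖ = 1 := by
    rw [he, innerNormal, norm_neg, norm_smul, norm_inv, norm_norm, ← hm, inv_mul_cancel₀ hmpos.ne']
  have hA' : formOf A ∈ interior (formSet F.carrier) := by
    rw [interior_formSet]
    change toSym (formOf A) ∈ interior F.carrier
    rwa [toSym_formOf]
  have hAB : ∀ v, ⟪formOf A v, v⟫ = m⁻¹ * ⟪hessOp ρ x (v - ⟪e, v⟫ • e), v - ⟪e, v⟫ • e⟫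
      + t * ⟪e, v⟫ ^ 2 := by
    intro v
    have hP : (1 - projMat e) *ᵥ v.ofLp = (v - ⟪e, v⟫ • e).ofLp := by
      rw [Matrix.sub_mulVec, Matrix.one_mulVec, projMat_mulVec]
      rfl
    have hPs : v.ofLp ᵥ* (1 - projMat e) = (1 - projMat e) *ᵥ v.ofLp := by
      rw [← Matrix.mulVec_transpose]
      congr 1
      ext i j
      simp [projMat, Matrix.one_apply, eq_comm, mul_comm]
    have hPe : v.ofLp ⬝ᵥ (projMat e *ᵥ v.ofLp) = ⟪e, v⟫ ^ 2 := by
      rw [← inner_tensorSq, inner_eq_dotProduct_toSym, toSym_tensorSq]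
      rfl
    rw [inner_eq_dotProduct_toSym, toSym_formOf, hAeq, Matrix.add_mulVec, dotProduct_add,
      Matrix.smul_mulVec, dotProduct_smul, hPe, secondFF, Matrix.smul_mulVec, dotProduct_smul,
      ← he, ← hm, ← Matrix.mulVec_mulVec, ← Matrix.mulVec_mulVec, Matrix.dotProduct_mulVec,
      hPs, hP, hessMatrix_eq hρ.contDiffAt, inner_eq_dotProduct_toSym (hessOp ρ x)]
    rfl
  obtain ⟨s₀, hs₀⟩ := (ConeSubequation.isSubeq F).exists_add_smul_mem_interior
    (fun B hB t ht => F.smul_mem hB ht) hmpos hA' hAB he1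
  refine ⟨(|s₀| + 1) / (2 * m ^ 2), by positivity, ?_⟩
  have h1 : (2 * ((|s₀| + 1) / (2 * m ^ 2))) • tensorSq (gradient ρ x)
      = (|s₀| + 1) • tensorSq e := by
    have h2 : gradient ρ x = -(m • e) := by
      rw [he, innerNormal, ← hm, smul_neg, neg_neg, smul_inv_smul₀ hmpos.ne']
    ext1 v
    simp only [tensorSq, h2, smul_apply, ContinuousLinearMap.smulRight_apply, innerSL_apply_apply,
      inner_neg_left, real_inner_smul_left, smul_neg, neg_mul, neg_smul, neg_neg, smul_smul]
    congr 1
    field_simp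
  rw [h1]
  exact hs₀ _ (by linarith [le_abs_self s₀])

lemma neg_tensorSq_notMem {F : ConeSubequation n} (hF3 : CondF3 F) {p : EucSp n} (hp : p ≠ 0) :
    -tensorSq p ∉ formSet F.carrier := by
  intro hmem
  have hpos : 0 < ‖p‖ := norm_pos_iff.2 hp
  have h1 := F.smul_mem hmem (t := (‖p‖ ^ 2)⁻¹) (by positivity)
  have h2 : (‖p‖ ^ 2)⁻¹ • -tensorSq p = -tensorSq (‖p‖⁻¹ • p) := by
    ext1 v
    simp only [tensorSq, smul_apply, neg_apply, ContinuousLinearMap.smulRight_apply,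
      innerSL_apply_apply, real_inner_smul_left, smul_neg, smul_smul]
    congr 2
    field_simp
  rw [h2] at h1
  change toSym _ ∈ F.carrier at h1
  rw [toSym_neg, toSym_tensorSq] at h1
  refine hF3 _ ?_ h1
  rw [norm_smul, norm_inv, norm_norm, inv_mul_cancel₀ hpos.ne']

end StrictConvexity

/-- Theorem 6.5, the (DPPS) with singularities on a compact polar set:
existence holds for every continuous boundary function (using the strict F-convexity of
∂Ω), and uniqueness holds without the boundary convexity assumption. -/
theorem dirichlet_singularities_stmt11 {n : ℕ} (F : ConeSubequation n) (hF3 : CondF3 F)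
    (Ω : Set (EucSp n)) (hΩ : IsBoundedDomain Ω)
    (Z : Set (EucSp n)) (hZΩ : Z ⊆ Ω) (hZc : IsCompact Z)
    (h : EucSp n → EReal) (hhc : ContinuousOn h (closure Ω))
    (hhtop : ∀ y ∈ closure Ω, h y ≠ ⊤)
    (hZ : ∀ y ∈ closure Ω, (h y = ⊥ ↔ y ∈ Z))
    (hsub : FSubharmonicOn F.carrier Ω h)
    (hharm : FHarmonicOn F (Ω \ Z) h)
    (φ : EucSp n → ℝ) (hφ : ContinuousOn φ (frontier Ω)) :
    (StrictlyConvexBoundary F Ω → ∃ H : EucSp n → ℝ, IsPolarSetSolution F Ω Z φ h H) ∧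
    (∀ H₁ H₂ : EucSp n → ℝ, IsPolarSetSolution F Ω Z φ h H₁ →
      IsPolarSetSolution F Ω Z φ h H₂ → Set.EqOn H₁ H₂ (closure Ω \ Z)) := by
  have hW : IsOpen (Ω \ Z) := hΩ.1.sdiff hZc.isClosed
  refine ⟨?_, fun H₁ H₂ h₁ h₂ => h₁.eqOn hΩ hZΩ hZc hhc hhtop hZ hφ h₂⟩
  rintro ⟨ρ, hρ, hΩρ, hconv⟩
  have hρ2 : ContDiff ℝ 2 ρ := contDiff_infty.1 hρ 2
  have hle : ∀ y ∈ closure Ω, ρ y ≤ 0 := by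
    refine closure_minimal (fun y hy => ?_) (isClosed_le hρ.continuous continuous_const)
    rw [hΩρ] at hy
    exact (show ρ y < 0 from hy).le
  have hzero : ∀ y ∈ frontier Ω, ρ y = 0 := by
    intro y hy
    refine le_antisymm (hle y (frontier_subset_closure hy)) (not_lt.1 fun hlt => ?_)
    rw [hΩ.1.frontier_eq] at hy
    exact hy.2 (by rw [hΩρ]; exact hlt)
  have hreal : ∀ y ∈ Ω \ Z, ((h y).toReal : EReal) = h y := fun y hy =>
    coe_toReal_singular hhtop hZ ⟨subset_closure hy.1, hy.2⟩
  have hharm' : FHarmonicOn F (Ω \ Z) fun y => ((h y).toReal : EReal) :=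
    ⟨hharm.1.congr fun y hy => (hreal y hy).symm,
      hharm.2.congr fun y hy => congrArg Neg.neg (hreal y hy).symm⟩
  rw [fHarmonicOn_coe_iff hW] at hharm'
  refine (exists_dirichlet_solution F.isSubeq
    (fun B hB t ht => F.smul_mem hB ht) hΩ.1 hΩ.2.2 hZΩ hZc.isClosed hφ
    (continuousOn_toReal_singular hhc hhtop hZ)
    (fun x hx m => eventually_toReal_le hhc hhtop hZ (subset_closure (hZΩ hx)) hx m)
    hharm'.1 hharm'.2 (fun x₀ hx₀ => ?_) (fun x₀ hx₀ => ?_)).imp ?_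
  · obtain ⟨hgrad, t₀, ht₀⟩ := hconv x₀ hx₀
    obtain ⟨K, hK, hBint⟩ := exists_hessOp_add_mem_interior F hρ2 hgrad (ht₀ t₀ le_rfl)
    obtain ⟨q, hqc, hq0, a, ha, hq⟩ := exists_lower_barrier hρ2 (hzero x₀ hx₀) hK hBint
    exact ⟨q, hqc, hq0, a, ha, hq.mono fun y hy => ⟨hy.1, fun hyc => hy.2 (hle y hyc)⟩⟩
  · obtain ⟨q, hqc, hq0, hq⟩ := exists_upper_barrier F.isSubeq
      (fun B hB t ht => F.smul_mem hB ht) hρ2 (hzero x₀ hx₀)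
      (neg_tensorSq_notMem hF3 (hconv x₀ hx₀).1)
    exact ⟨q, hqc, hq0, hq.mono fun y hy => ⟨hy.1, fun hyc => hy.2 (hle y hyc)⟩⟩
  · rintro H ⟨hHc, hHs, hHd, hHφ, c, C, hH⟩
    refine ⟨hHc, (fHarmonicOn_coe_iff hW).2 ⟨hHs, hHd⟩, hHφ, c, C, fun y hy => ?_⟩
    rw [← hreal y hy]
    exact_mod_cast hH y hy
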